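/- Let C be a smooth connected projective complex curve of genus g and L a very ample line bundle on C with deg L ≥ g+3 such that the corresponding embedding of C into P(H^0(L)^*) is projectively normal. Assume there exists a divisor D = P_1 + ... + P_d of d distinct points, of degree d = deg L − g − 1 + 2h^1(L), such that the linear series |D| and |L(-D)| are base-point free of dimensions deg L − 2g + 4h^1(L) − 1 and 1 respectively, that h^1(L(D)) = h^1(L^2(-D)) = 0, and that any h^1(L) points of D impose independent conditions on K ⊗ L^{-1}(D). Then the algebra R_L = ⊕_{n≥0} H^0(C, L^n) is Koszul. -/

import Mathlib

open TensorProduct Function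

noncomputable section


/-!  ### Graded algebras presented by their components

An ℕ-graded algebra `R = ⊕ₙ Rₙ` over a field `k` (with `R₀ = k`) is presented here through
its graded components, realized as `k`-subspaces `piece n` of an ambient `k`-algebra `A`,
with `1 ∈ piece 0` and `piece m * piece n ⊆ piece (m + n)`.  All notions below (Koszulness,
quadraticity) depend only on the components and the componentwise multiplication maps. -/
structure GradedSystem (k A : Type) [Field k] [Ring A] [Algebra k A] where
  piece : ℕ → Submodule k A
  one_mem : (1 : A) ∈ piece 0
  mul_mem : ∀ {m n : ℕ} {x y : A}, x ∈ piece m → y ∈ piece n → x * y ∈ piece (m + n)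

namespace GradedSystem

variable {k A : Type} [Field k] [Ring A] [Algebra k A] (S : GradedSystem k A)

/-- The componentwise multiplication map `Rₘ ⊗ Rₙ → R_{m+n}`. -/
def mulMap (m n : ℕ) : S.piece m →ₗ[k] S.piece n →ₗ[k] S.piece (m + n) :=
  LinearMap.mk₂ k (fun x y => ⟨(x : A) * (y : A), S.mul_mem x.2 y.2⟩)
    (fun x x' y => Subtype.ext (by simp [add_mul]))
    (fun c x y => Subtype.ext (by simp [smul_mul_assoc]))
    (fun x y y' => Subtype.ext (by simp [mul_add]))
    (fun c x y => Subtype.ext (by simp [mul_smul_comm]))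

/-- Transport of a graded component along an equality of degrees. -/
def cast {m n : ℕ} (h : m = n) : (S.piece m : Type) ≃ₗ[k] S.piece n :=
  LinearEquiv.ofEq _ _ (by rw [h])

/-- The degree-`d` component of the differential
`V_{i+1} ⊗ R(-(i+1)) → V_i ⊗ R(-i)` of a complex of free graded (right) `R`-modules with
`V_i = k^{n i}` generated in degree `i`; the differential is encoded by its
restriction `φ i : V_{i+1} → V_i ⊗ R₁` to the generators (a "matrix of linear forms").
The degree-`(i+1+d)` component of the map is `V_{i+1} ⊗ R_d → V_i ⊗ R_{d+1}`. -/
def Dmap (n : ℕ → ℕ)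
    (φ : ∀ i : ℕ, (Fin (n (i + 1)) → k) →ₗ[k] ((Fin (n i) → k) ⊗[k] S.piece 1))
    (i d : ℕ) :
    ((Fin (n (i + 1)) → k) ⊗[k] S.piece d) →ₗ[k] ((Fin (n i) → k) ⊗[k] S.piece (d + 1)) :=
  (LinearMap.lTensor (Fin (n i) → k)
      ((S.cast (add_comm 1 d)).toLinearMap ∘ₗ TensorProduct.lift (S.mulMap 1 d))) ∘ₗ
    (TensorProduct.assoc k (Fin (n i) → k) (S.piece 1) (S.piece d)).toLinearMap ∘ₗ
    (LinearMap.rTensor (S.piece d) (φ i))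

/-- `S` is connected: the degree-zero component is spanned by the unit, i.e. `R₀ = k`. -/
def ConnectedOne : Prop := S.piece 0 = Submodule.span k {(1 : A)}

/-- `S` is a *Koszul algebra*: `R₀ = k` and the trivial module `k` admits a linear free
resolution `⋯ → V₂ ⊗ R(-2) → V₁ ⊗ R(-1) → R → k → 0` (this is one of the standard
equivalent definitions of Koszulness: `Extⁿ(k, k(-m)) = 0` for `n ≠ m`).
Exactness is expressed by its graded components: surjectivity of `V₁ ⊗ R_d → R_{d+1}`
(exactness at `R` in positive degrees), injectivity of `V_{i+1} ⊗ R₀ → V_i ⊗ R₁`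
(exactness in the lowest degree at each spot), and `range = ker` elsewhere. -/
def IsKoszul : Prop :=
  S.ConnectedOne ∧
  ∃ (n : ℕ → ℕ)
    (φ : ∀ i : ℕ, (Fin (n (i + 1)) → k) →ₗ[k] ((Fin (n i) → k) ⊗[k] S.piece 1)),
    n 0 = 1 ∧
    (∀ d : ℕ, Surjective (S.Dmap n φ 0 d)) ∧
    (∀ i : ℕ, Injective (S.Dmap n φ i 0)) ∧
    (∀ i d : ℕ, LinearMap.range (S.Dmap n φ (i + 1) d) = LinearMap.ker (S.Dmap n φ i (d + 1)))

/-- `S` is a *quadratic algebra*: `R₀ = k`, `R` is generated by `R₁` and its relations are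
generated in degree `2`; equivalently there is an exact sequence
`V₂ ⊗ R(-2) → V₁ ⊗ R(-1) → R → k → 0` (exact at `V₁ ⊗ R(-1)` and at `R`). -/
def IsQuadratic : Prop :=
  S.ConnectedOne ∧
  ∃ (n : ℕ → ℕ)
    (φ : ∀ i : ℕ, (Fin (n (i + 1)) → k) →ₗ[k] ((Fin (n i) → k) ⊗[k] S.piece 1)),
    n 0 = 1 ∧
    (∀ d : ℕ, Surjective (S.Dmap n φ 0 d)) ∧
    Injective (S.Dmap n φ 0 0) ∧
    (∀ d : ℕ, LinearMap.range (S.Dmap n φ 1 d) = LinearMap.ker (S.Dmap n φ 0 (d + 1)))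

end GradedSystem

/-- For `m = 1`, the canonical identification `(k^m) ⊗ M ≃ M`. -/
def oneTensorEquiv {k : Type} [Field k] {m : ℕ} (h : m = 1) (M : Type)
    [AddCommGroup M] [Module k M] : ((Fin m → k) ⊗[k] M) ≃ₗ[k] M :=
  (TensorProduct.congr
      ((LinearEquiv.funCongrLeft k k (finCongr h.symm)).trans
        (LinearEquiv.funUnique (Fin 1) k k))
      (LinearEquiv.refl k M)).trans (TensorProduct.lid k M)


/-!  ### Smooth connected projective complex curves

A smooth connected projective curve over `ℂ` is (equivalently) presented through its
function field `F` — a finitely generated extension of `ℂ` of transcendence degree 1 —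
together with its set of points (= places of `F/ℂ`), each point giving an
order-of-vanishing valuation `ord P : F → ℤ`.  Divisors are finitely supported `ℤ`-valued
functions on points, and `H⁰(C, O(D))` is the Riemann–Roch space of `D`. -/
structure PreCurve where
  /-- the function field of the curve -/
  F : Type
  [fieldF : Field F]
  [algF : Algebra ℂ F]
  /-- `F` is a finitely generated extension of `ℂ` of transcendence degree 1 -/
  trdeg_one : ∃ x : F, Transcendental ℂ x ∧
    FiniteDimensional (IntermediateField.adjoin ℂ {x}) F
  /-- the (closed) points of the curve -/
  Point : Type
  /-- order of vanishing of a rational function at a point -/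
  ord : Point → F → ℤ
  ord_zero' : ∀ P, ord P 0 = 0
  ord_mul : ∀ P, ∀ f g : F, f ≠ 0 → g ≠ 0 → ord P (f * g) = ord P f + ord P g
  ord_add : ∀ P, ∀ f g : F, f ≠ 0 → g ≠ 0 → f + g ≠ 0 →
    min (ord P f) (ord P g) ≤ ord P (f + g)
  ord_algebraMap : ∀ P, ∀ c : ℂ, c ≠ 0 → ord P (algebraMap ℂ F c) = 0
  /-- every point admits a local uniformizer (the valuation is surjective) -/
  ord_uniformizer : ∀ P, ∃ f : F, f ≠ 0 ∧ ord P f = 1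
  /-- a nonzero rational function has only finitely many zeros and poles -/
  ord_finite_support : ∀ f : F, f ≠ 0 → (Function.support fun P => ord P f).Finite
  /-- distinct points are separated by rational functions -/
  ord_separates : ∀ P Q : Point, P ≠ Q → ∃ f : F, f ≠ 0 ∧ 0 < ord P f ∧ ord Q f = 0

attribute [instance] PreCurve.fieldF PreCurve.algF

namespace PreCurve

variable (C : PreCurve)

/-- Divisors on the curve. -/
abbrev Div := C.Point →₀ ℤ

/-- The divisor of a single point. -/
def pt (P : C.Point) : C.Div := Finsupp.single P 1

/-- The degree of a divisor. -/
def deg (D : C.Div) : ℤ := D.sum fun _ n => n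

/-- The Riemann–Roch space `H⁰(C, O(D)) = {f ∈ F | div f + D ≥ 0} ∪ {0}`. -/
def H0 (D : C.Div) : Submodule ℂ C.F where
  carrier := {f : C.F | f = 0 ∨ ∀ P, 0 ≤ C.ord P f + D P}
  zero_mem' := Or.inl rfl
  add_mem' := by
    intro f g hf hg
    rcases eq_or_ne f 0 with rfl | hf0
    · simpa using hg
    rcases eq_or_ne g 0 with rfl | hg0
    · simpa using hf
    rcases eq_or_ne (f + g) 0 with h0 | h0
    · exact Or.inl h0
    rcases hf with rfl | hf
    · exact absurd rfl hf0
    rcases hg with rfl | hg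
    · exact absurd rfl hg0
    refine Or.inr fun P => ?_
    have hmin := C.ord_add P f g hf0 hg0 h0
    rcases le_total (C.ord P f) (C.ord P g) with hle | hle
    · rw [min_eq_left hle] at hmin
      have := hf P; omega
    · rw [min_eq_right hle] at hmin
      have := hg P; omega
  smul_mem' := by
    intro c f hf
    rcases eq_or_ne c 0 with rfl | hc
    · exact Or.inl (zero_smul ℂ f)
    rcases hf with rfl | hf
    · exact Or.inl (smul_zero c)
    rcases eq_or_ne f 0 with rfl | hf0
    · exact Or.inl (smul_zero c)
    refine Or.inr fun P => ?_
    have hmap : (algebraMap ℂ C.F c) ≠ 0 := fun h =>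
      hc ((algebraMap ℂ C.F).injective (by rw [h, map_zero]))
    have hsm : c • f = algebraMap ℂ C.F c * f := Algebra.smul_def c f
    rw [hsm, C.ord_mul P _ f hmap hf0, C.ord_algebraMap P c hc]
    simpa using hf P

theorem mem_H0 {D : C.Div} {f : C.F} :
    f ∈ C.H0 D ↔ (f = 0 ∨ ∀ P, 0 ≤ C.ord P f + D P) := Iff.rfl

/-- `h⁰(D) = dim H⁰(C, O(D))`. -/
def h0 (D : C.Div) : ℕ := Module.finrank ℂ (C.H0 D)

theorem H0_mono {D E : C.Div} (h : ∀ P, D P ≤ E P) : C.H0 D ≤ C.H0 E := by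
  intro f hf
  rcases (C.mem_H0.mp hf) with rfl | hf
  · exact (C.H0 E).zero_mem
  · exact C.mem_H0.mpr (Or.inr fun P => by have := h P; have := hf P; omega)

theorem mul_mem_H0 {D E : C.Div} {f g : C.F} (hf : f ∈ C.H0 D) (hg : g ∈ C.H0 E) :
    f * g ∈ C.H0 (D + E) := by
  rcases (C.mem_H0.mp hf) with rfl | hf
  · exact C.mem_H0.mpr (Or.inl (zero_mul g))
  rcases (C.mem_H0.mp hg) with rfl | hg
  · exact C.mem_H0.mpr (Or.inl (mul_zero f))
  rcases eq_or_ne f 0 with rfl | hf0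
  · exact C.mem_H0.mpr (Or.inl (zero_mul g))
  rcases eq_or_ne g 0 with rfl | hg0
  · exact C.mem_H0.mpr (Or.inl (mul_zero f))
  refine C.mem_H0.mpr (Or.inr fun P => ?_)
  rw [C.ord_mul P f g hf0 hg0, Finsupp.add_apply]
  have := hf P; have := hg P; omega

/-- Multiplication of sections, `H⁰(D) ⊗ H⁰(E) → H⁰(D + E)`, as a bilinear map. -/
def mulH0 (D E : C.Div) : C.H0 D →ₗ[ℂ] C.H0 E →ₗ[ℂ] C.H0 (D + E) :=
  LinearMap.mk₂ ℂ (fun f g => ⟨(f : C.F) * (g : C.F), C.mul_mem_H0 f.2 g.2⟩)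
    (fun f f' g => Subtype.ext (by simp [add_mul]))
    (fun c f g => Subtype.ext (by simp [smul_mul_assoc]))
    (fun f g g' => Subtype.ext (by simp [mul_add]))
    (fun c f g => Subtype.ext (by simp [mul_smul_comm]))

/-- Transport of `H⁰` along an equality of divisors. -/
def castH0 {D E : C.Div} (h : D = E) : (C.H0 D : Type) ≃ₗ[ℂ] C.H0 E :=
  LinearEquiv.ofEq _ _ (by rw [h])

/-- The multiplication map `H⁰(D) ⊗ H⁰(E) → H⁰(G)` for `G = D + E`. -/
def mulTo (D E G : C.Div) (h : D + E = G) : (C.H0 D ⊗[ℂ] C.H0 E) →ₗ[ℂ] C.H0 G :=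
  (C.castH0 h).toLinearMap ∘ₗ TensorProduct.lift (C.mulH0 D E)

/-- The inclusion `H⁰(D) ⊆ H⁰(E)` for `D ≤ E`. -/
def inclH0 {D E : C.Div} (h : ∀ P, D P ≤ E P) : (C.H0 D : Type) →ₗ[ℂ] C.H0 E :=
  Submodule.inclusion (C.H0_mono h)

/-- Multiplication by a fixed section `a ∈ H⁰(E)`, as a map `H⁰(M) → H⁰(E + M)`. -/
def mulBy {E : C.Div} (a : C.F) (ha : a ∈ C.H0 E) (M : C.Div) :
    (C.H0 M : Type) →ₗ[ℂ] C.H0 (E + M) :=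
  C.mulH0 E M ⟨a, ha⟩

/-- The reduced effective divisor attached to a finite set of points. -/
def divOfFinset (s : Finset C.Point) : C.Div := ∑ P ∈ s, C.pt P

/-- The divisor of a nonzero rational function. -/
def divOf (f : C.F) : C.Div := by
  classical
  exact if h : f = 0 then 0
    else Finsupp.ofSupportFinite (fun P => C.ord P f) (C.ord_finite_support f h)

/-- Linear equivalence of divisors. -/
def LinEquiv (D E : C.Div) : Prop := ∃ f : C.F, f ≠ 0 ∧ D - E = C.divOf f

end PreCurve

/-- A smooth connected projective complex curve: the data of `PreCurve` together with
properness (principal divisors have degree zero), finite–dimensionality of Riemann–Roch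
spaces, `H⁰(O) = ℂ`, a canonical divisor `K`, and the genus, tied together by the
Riemann–Roch theorem (in its Serre-duality form `h⁰(D) − h⁰(K−D) = deg D + 1 − g`). -/
structure Curve extends PreCurve where
  deg_principal : ∀ f : toPreCurve.F, f ≠ 0 → (∑ᶠ P, toPreCurve.ord P f) = 0
  finiteDim : ∀ D : toPreCurve.Div, FiniteDimensional ℂ (toPreCurve.H0 D)
  h0_triv : toPreCurve.h0 0 = 1
  /-- a canonical divisor (class) of the curve -/
  K : toPreCurve.Div
  /-- the genus of the curve -/
  genus : ℕ
  riemann_roch : ∀ D : toPreCurve.Div,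
    (toPreCurve.h0 D : ℤ) - toPreCurve.h0 (K - D) = toPreCurve.deg D + 1 - genus

namespace Curve

variable (C : Curve)

/-- `h¹(D)`, via Serre duality. -/
def h1 (D : C.Div) : ℕ := C.h0 (C.K - D)

/-- The complete linear system `|D|` is base-point free. -/
def BasePointFree (D : C.Div) : Prop := ∀ P : C.Point, C.h0 (D - C.pt P) + 1 = C.h0 D

/-- `|D|` is a base-point-free pencil (base-point free of projective dimension 1). -/
def IsBPFPencil (D : C.Div) : Prop := C.BasePointFree D ∧ C.h0 D = 2

/-- `C` is hyperelliptic: it carries a `g¹₂`. -/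
def Hyperelliptic : Prop := ∃ D : C.Div, C.deg D = 2 ∧ 2 ≤ C.h0 D

/-- `C` is trigonal: it admits a degree-3 map to `ℙ¹`. -/
def Trigonal : Prop := ∃ D : C.Div, C.deg D = 3 ∧ 2 ≤ C.h0 D ∧ C.BasePointFree D

/-- `D` is very ample (it separates points and tangent vectors). -/
def VeryAmple (D : C.Div) : Prop :=
  ∀ P Q : C.Point, C.h0 (D - C.pt P - C.pt Q) + 2 = C.h0 D

/-- `C` is a smooth plane quintic: it carries a very ample `g²₅`. -/
def IsPlaneQuintic : Prop := ∃ D : C.Div, C.deg D = 5 ∧ C.h0 D = 3 ∧ C.VeryAmple D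

/-- The homogeneous coordinate algebra `R_L = ⊕ₙ H⁰(C, Lⁿ)` of a divisor (class) `L`,
as a graded system inside the function field. -/
def RL (L : C.Div) : GradedSystem ℂ C.F where
  piece n := C.H0 (n • L)
  one_mem := by
    refine C.mem_H0.mpr (Or.inr fun P => ?_)
    have h1 : C.ord P 1 = 0 := by
      simpa using C.ord_algebraMap P 1 one_ne_zero
    simp [h1]
  mul_mem := by
    intro m n x y hx hy
    have h := C.mul_mem_H0 hx hy
    show x * y ∈ C.H0 ((m + n) • L)
    rwa [add_smul]

/-- The embedding given by the complete linear system `|L|` is projectively normal: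
`R_L` is generated in degree one (equivalently, `Symⁿ H⁰(L) → H⁰(Lⁿ)` is surjective
for all `n`). -/
def ProjectivelyNormal (L : C.Div) : Prop :=
  ∀ n : ℕ, Surjective
    (C.mulTo L (n • L) ((n + 1) • L) ((add_comm L (n • L)).trans (succ_nsmul L n).symm))

end Curve

/-- The homology of a (two-step) complex `X → Y → Z` at `Y`. -/
def homol {X Y Z : Type} [AddCommGroup X] [AddCommGroup Y] [AddCommGroup Z]
    [Module ℂ X] [Module ℂ Y] [Module ℂ Z] (f : X →ₗ[ℂ] Y) (g : Y →ₗ[ℂ] Z) : Type :=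
  ↥(LinearMap.ker g) ⧸ Submodule.comap (LinearMap.ker g).subtype (LinearMap.range f)

namespace GradedSystem

variable {k A : Type} [Field k] [CommRing A] [Algebra k A]

/-- Multiplication `Rᵢ × Rⱼ → Rₗ` for `i + j = l`. -/
def mul (S : GradedSystem k A) {i j l : ℕ} (h : i + j = l) :
    S.piece i →ₗ[k] S.piece j →ₗ[k] S.piece l :=
  LinearMap.mk₂ k (fun x y => ⟨(x : A) * (y : A), h ▸ S.mul_mem x.2 y.2⟩)
    (fun x x' y => Subtype.ext (by simp [add_mul]))
    (fun c x y => Subtype.ext (by simp [smul_mul_assoc]))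
    (fun x y y' => Subtype.ext (by simp [mul_add]))
    (fun c x y => Subtype.ext (by simp [mul_smul_comm]))

@[simp] theorem coe_mul (S : GradedSystem k A) {i j l : ℕ} (h : i + j = l)
    (x : S.piece i) (y : S.piece j) : (S.mul h x y : A) = x * y := rfl

/-- The unit, as an element of `R₀`. -/
def unit (S : GradedSystem k A) : S.piece 0 := ⟨1, S.one_mem⟩

/-- A graded module over the graded algebra `S`, given by its components in degrees `≥ 0`. -/
structure Mod (S : GradedSystem k A) where
  C : ℕ → Type
  [addCommGroup : ∀ j, AddCommGroup (C j)]
  [module : ∀ j, Module k (C j)]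
  act : ∀ {i j l : ℕ}, i + j = l → S.piece i →ₗ[k] C j →ₗ[k] C l
  one_act : ∀ {j : ℕ} (m : C j), act (zero_add j) S.unit m = m
  mul_act : ∀ {i j p q l : ℕ} (h : i + j = p) (h' : p + q = l) {t : ℕ} (h₁ : j + q = t)
    (h₂ : i + t = l) (x : S.piece i) (y : S.piece j) (m : C q),
    act h' (S.mul h x y) m = act h₂ x (act h₁ y m)

namespace Mod

attribute [instance] Mod.addCommGroup Mod.module

variable {S : GradedSystem k A}

/-- The action map `M₀ ⊗ Rⱼ → Mⱼ`. -/
def eval (M : S.Mod) (j : ℕ) : M.C 0 ⊗[k] S.piece j →ₗ[k] M.C j :=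
  TensorProduct.lift (M.act (add_zero j)).flip

@[simp] theorem eval_tmul (M : S.Mod) (j : ℕ) (m : M.C 0) (r : S.piece j) :
    M.eval j (m ⊗ₜ r) = M.act (add_zero j) r m := rfl

theorem eval_mul (M : S.Mod) {i j l : ℕ} (h : i + j = l) (r : S.piece i)
    (x : M.C 0 ⊗[k] S.piece j) :
    M.eval l (LinearMap.lTensor _ (S.mul h r) x) = M.act h r (M.eval j x) := by
  induction x with
  | zero => simp
  | add x y hx hy => simp only [map_add, hx, hy]
  | tmul m s => simpa using M.mul_act h (add_zero l) (add_zero j) h r s m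

/-- The first syzygy module of the generators in degree `0`, shifted to start in degree `0`:
its component of degree `j` is the kernel of `M₀ ⊗ R_{j+1} → M_{j+1}`. -/
def syz (M : S.Mod) : S.Mod where
  C j := LinearMap.ker (M.eval (j + 1))
  act {i j l} h := LinearMap.mk₂ k
    (fun r x => ⟨LinearMap.lTensor _ (S.mul (show i + (j + 1) = l + 1 by omega) r) x.1, by
      rw [LinearMap.mem_ker, eval_mul, LinearMap.mem_ker.mp x.2, map_zero]⟩)
    (fun r r' x => Subtype.ext (by simp [LinearMap.lTensor_add]))
    (fun c r x => Subtype.ext (by simp [LinearMap.lTensor_smul]))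
    (fun r x x' => Subtype.ext (by simp))
    (fun c r x => Subtype.ext (by simp))
  one_act {j} x := Subtype.ext (by
    have : S.mul (zero_add (j + 1)) S.unit = LinearMap.id := by
      ext; simp [unit]
    simp [this])
  mul_act {i j p q l} h h' {t} h₁ h₂ x y m := Subtype.ext (by
    have : S.mul (show p + (q + 1) = l + 1 by omega) (S.mul h x y) =
        S.mul (show i + (t + 1) = l + 1 by omega) x ∘ₗ
          S.mul (show j + (q + 1) = t + 1 by omega) y := by
      ext; simp [mul_assoc]
    simp only [LinearMap.mk₂_apply, this, LinearMap.lTensor_comp_apply])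

theorem coe_syz_act (M : S.Mod) {i j l : ℕ} (h : i + j = l) (r : S.piece i) (x : M.syz.C j) :
    (M.syz.act h r x).1 =
      LinearMap.lTensor _ (S.mul (show i + (j + 1) = l + 1 by omega) r) x.1 := rfl

/-- `M` is generated in degree `0`. -/
def Gen (M : S.Mod) : Prop := ∀ j, Surjective (M.eval j)

/-- The minimal free resolution of `M` is linear in homological degrees `≤ i`. -/
def Lin : ℕ → S.Mod → Prop
  | 0, M => M.Gen
  | i + 1, M => M.Gen ∧ Lin i M.syz

theorem Lin.gen {i : ℕ} {M : S.Mod} (h : Lin i M) : M.Gen := by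
  cases i with
  | zero => exact h
  | succ i => exact h.1

theorem Lin.of_succ {i : ℕ} {M : S.Mod} (h : Lin (i + 1) M) : Lin i M := by
  induction i generalizing M with
  | zero => exact h.1
  | succ i ih => exact ⟨h.1, ih h.2⟩

theorem Lin.of_subsingleton (i : ℕ) {M : S.Mod} (h : ∀ j, Subsingleton (M.C j)) : Lin i M := by
  induction i generalizing M with
  | zero => exact fun j y => ⟨0, (h j).elim _ _⟩
  | succ i ih =>
    refine ⟨fun j y => ⟨0, (h j).elim _ _⟩, ih fun j => ⟨fun x y => Subtype.ext ?_⟩⟩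
    have hz : ∀ z : M.C 0 ⊗[k] S.piece (j + 1), z = 0 := by
      intro z
      induction z with
      | zero => rfl
      | add x y hx hy => rw [hx, hy, add_zero]
      | tmul m s => rw [(h 0).elim m 0, TensorProduct.zero_tmul]
    rw [hz x.1, hz y.1]

/-- A family of linear maps of degree `e` is compatible with the action. -/
def IsHom {M N : S.Mod} (e : ℕ) (f : ∀ j, M.C j →ₗ[k] N.C (j + e)) : Prop :=
  ∀ {i j l : ℕ} (h : i + j = l) (r : S.piece i) (m : M.C j),
    f l (M.act h r m) = N.act (show i + (j + e) = l + e by omega) r (f j m)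

theorem eval_rTensor {M N : S.Mod} {f : ∀ j, M.C j →ₗ[k] N.C j} (hf : IsHom 0 f) (j : ℕ)
    (x : M.C 0 ⊗[k] S.piece j) :
    N.eval j (LinearMap.rTensor _ (f 0) x) = f j (M.eval j x) := by
  induction x with
  | zero => simp
  | add x y hx hy => simp only [map_add, hx, hy]
  | tmul m s => simpa using (hf (add_zero j) s m).symm

theorem lTensor_rTensor_comm {V W X Y : Type} [AddCommGroup V] [AddCommGroup W] [AddCommGroup X]
    [AddCommGroup Y] [Module k V] [Module k W] [Module k X] [Module k Y]
    (f : V →ₗ[k] W) (g : X →ₗ[k] Y) (x : V ⊗[k] X) :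
    LinearMap.lTensor W g (LinearMap.rTensor X f x) =
      LinearMap.rTensor Y f (LinearMap.lTensor V g x) := by
  rw [← LinearMap.comp_apply, ← LinearMap.comp_apply, LinearMap.lTensor_comp_rTensor,
    LinearMap.rTensor_comp_lTensor]

/-- The map induced on syzygy modules. -/
def syzMap {M N : S.Mod} {f : ∀ j, M.C j →ₗ[k] N.C j} (hf : IsHom 0 f) (j : ℕ) :
    M.syz.C j →ₗ[k] N.syz.C j :=
  (LinearMap.rTensor (S.piece (j + 1)) (f 0)).restrict fun x hx => by
    rw [LinearMap.mem_ker, eval_rTensor hf, LinearMap.mem_ker.mp hx, map_zero]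

theorem coe_syzMap {M N : S.Mod} {f : ∀ j, M.C j →ₗ[k] N.C j} (hf : IsHom 0 f) (j : ℕ)
    (x : M.syz.C j) :
    (syzMap hf j x).1 = LinearMap.rTensor (S.piece (j + 1)) (f 0) x.1 := rfl

theorem isHom_syzMap {M N : S.Mod} {f : ∀ j, M.C j →ₗ[k] N.C j} (hf : IsHom 0 f) :
    IsHom 0 (syzMap hf) := fun {i j l} h r m => Subtype.ext (by
  rw [coe_syzMap, coe_syz_act, ← lTensor_rTensor_comm]; rfl)

theorem rTensor_injective {V W X : Type} [AddCommGroup V] [AddCommGroup W] [AddCommGroup X]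
    [Module k V] [Module k W] [Module k X] {f : V →ₗ[k] W} (hf : Injective f) :
    Injective (LinearMap.rTensor X f) :=
  Module.Flat.rTensor_preserves_injective_linearMap f hf

theorem Gen.extension {M' M M'' : S.Mod} {f : ∀ j, M'.C j →ₗ[k] M.C j}
    {g : ∀ j, M.C j →ₗ[k] M''.C j} (hf : IsHom 0 f) (hg : IsHom 0 g)
    (exact : ∀ j, Exact (f j) (g j)) (surj : Surjective (g 0))
    (h' : M'.Gen) (h'' : M''.Gen) : M.Gen := by
  intro j y
  obtain ⟨z, hz⟩ := h'' j (g j y)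
  obtain ⟨x, rfl⟩ := LinearMap.rTensor_surjective (S.piece j) surj z
  rw [eval_rTensor hg] at hz
  obtain ⟨w, hw⟩ := (exact j (y - M.eval j x)).mp (by rw [map_sub, hz, sub_self])
  obtain ⟨v, rfl⟩ := h' j w
  refine ⟨x + LinearMap.rTensor _ (f 0) v, ?_⟩
  rw [map_add, eval_rTensor hf, hw]; abel

/-- An extension of linear modules is linear. -/
theorem Lin.extension {i : ℕ} {M' M M'' : S.Mod} {f : ∀ j, M'.C j →ₗ[k] M.C j}
    {g : ∀ j, M.C j →ₗ[k] M''.C j} (hf : IsHom 0 f) (hg : IsHom 0 g)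
    (inj : ∀ j, Injective (f j)) (exact : ∀ j, Exact (f j) (g j))
    (surj : ∀ j, Surjective (g j)) (h' : Lin i M') (h'' : Lin i M'') : Lin i M := by
  induction i generalizing M' M M'' with
  | zero => exact Gen.extension hf hg exact (surj 0) h' h''
  | succ i ih =>
    refine ⟨Gen.extension hf hg exact (surj 0) h'.1 h''.1,
      ih (isHom_syzMap hf) (isHom_syzMap hg) (fun j x y hxy =>
        Subtype.ext (rTensor_injective (inj 0) (congrArg Subtype.val hxy)))
        (fun j x => ?_) (fun j z => ?_) h'.2 h''.2⟩
    · have hex := rTensor_exact (S.piece (j + 1)) (exact 0) (surj 0)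
      constructor
      · intro hx
        obtain ⟨y, hy⟩ := (hex x.1).mp (congrArg Subtype.val hx)
        refine ⟨⟨y, ?_⟩, Subtype.ext hy⟩
        apply inj (j + 1)
        rw [map_zero, ← eval_rTensor hf, hy]
        exact x.2
      · rintro ⟨y, rfl⟩
        exact Subtype.ext ((hex _).mpr ⟨y.1, rfl⟩)
    · obtain ⟨x, hx⟩ := LinearMap.rTensor_surjective (S.piece (j + 1)) (surj 0) z.1
      obtain ⟨w, hw⟩ := (exact (j + 1) (M.eval (j + 1) x)).mp (by
        rw [← eval_rTensor hg, hx]; exact z.2)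
      obtain ⟨v, rfl⟩ := h'.gen (j + 1) w
      refine ⟨⟨x - LinearMap.rTensor _ (f 0) v, ?_⟩, Subtype.ext ?_⟩
      · rw [LinearMap.mem_ker, map_sub, eval_rTensor hf, hw, sub_self]
      · have := (rTensor_exact (S.piece (j + 1)) (exact 0) (surj 0)
          (LinearMap.rTensor _ (f 0) v)).mpr ⟨v, rfl⟩
        change LinearMap.rTensor _ (g 0) (x - LinearMap.rTensor _ (f 0) v) = z.1
        rw [map_sub, hx, this, sub_zero]

theorem Gen.of_surjective {M N : S.Mod} {g : ∀ j, M.C j →ₗ[k] N.C j} (hg : IsHom 0 g)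
    (surj : ∀ j, Surjective (g j)) (h : M.Gen) : N.Gen := by
  intro j y
  obtain ⟨z, rfl⟩ := surj j y
  obtain ⟨x, rfl⟩ := h j z
  exact ⟨LinearMap.rTensor _ (g 0) x, eval_rTensor hg j x⟩

/-- Linearity is invariant under isomorphisms. -/
theorem Lin.of_bijective {i : ℕ} {M N : S.Mod} {g : ∀ j, M.C j →ₗ[k] N.C j} (hg : IsHom 0 g)
    (bij : ∀ j, Bijective (g j)) (h : Lin i M) : Lin i N := by
  induction i generalizing M N with
  | zero => exact Gen.of_surjective hg (fun j => (bij j).2) h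
  | succ i ih =>
    refine ⟨Gen.of_surjective hg (fun j => (bij j).2) h.1, ih (isHom_syzMap hg) (fun j =>
      ⟨fun x y hxy =>
        Subtype.ext (rTensor_injective (bij 0).1 (congrArg Subtype.val hxy)), fun z => ?_⟩) h.2⟩
    obtain ⟨x, hx⟩ := LinearMap.rTensor_surjective (S.piece (j + 1)) (bij 0).2 z.1
    refine ⟨⟨x, (bij (j + 1)).1 ?_⟩, Subtype.ext hx⟩
    rw [map_zero, ← eval_rTensor hg, hx]
    exact z.2

/-- The quotient of a linear module by the shift of a linear module is linear. -/
theorem Lin.quotient {i : ℕ} {P M N : S.Mod} {f : ∀ j, P.C j →ₗ[k] M.C (j + 1)}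
    {g : ∀ j, M.C j →ₗ[k] N.C j} (hf : IsHom 1 f) (hg : IsHom 0 g)
    (inj : ∀ j, Injective (f j)) (exact : ∀ j, Exact (f j) (g (j + 1)))
    (inj₀ : Injective (g 0)) (surj : ∀ j, Surjective (g j))
    (hM : Lin (i + 1) M) (hP : Lin i P) : Lin (i + 1) N := by
  refine ⟨Gen.of_surjective hg surj hM.1, ?_⟩
  let e : M.C 0 ≃ₗ[k] N.C 0 := LinearEquiv.ofBijective (g 0) ⟨inj₀, surj 0⟩
  have he : ∀ (j : ℕ) (x : N.C 0 ⊗[k] S.piece j),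
      LinearMap.rTensor _ (g 0) (LinearMap.rTensor _ e.symm.toLinearMap x) = x := by
    intro j x
    rw [← LinearMap.rTensor_comp_apply, show g 0 ∘ₗ e.symm.toLinearMap = LinearMap.id from
      LinearMap.ext fun y => e.apply_symm_apply y, LinearMap.rTensor_id, LinearMap.id_apply]
  have he' : ∀ (j : ℕ) (x : M.C 0 ⊗[k] S.piece j),
      LinearMap.rTensor _ e.symm.toLinearMap (LinearMap.rTensor _ (g 0) x) = x := by
    intro j x
    rw [← LinearMap.rTensor_comp_apply, show e.symm.toLinearMap ∘ₗ g 0 = LinearMap.id from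
      LinearMap.ext fun y => e.symm_apply_apply y, LinearMap.rTensor_id, LinearMap.id_apply]
  let ρ : ∀ j, N.syz.C j →ₗ[k] M.C (j + 1) := fun j =>
    M.eval (j + 1) ∘ₗ LinearMap.rTensor _ e.symm.toLinearMap ∘ₗ Submodule.subtype _
  have hρ : ∀ j z, ρ j z = M.eval (j + 1) (LinearMap.rTensor _ e.symm.toLinearMap z.1) :=
    fun _ _ => rfl
  have hmem : ∀ j z, ρ j z ∈ LinearMap.range (f j) := by
    intro j z
    refine (exact j _).mp ?_
    rw [hρ, ← eval_rTensor hg, he]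
    exact z.2
  let π : ∀ j, N.syz.C j →ₗ[k] P.C j := fun j =>
    (LinearEquiv.ofInjective (f j) (inj j)).symm.toLinearMap ∘ₗ (ρ j).codRestrict _ (hmem j)
  have hπ : ∀ j z, f j (π j z) = ρ j z := fun j z =>
    congrArg Subtype.val ((LinearEquiv.ofInjective (f j) (inj j)).apply_symm_apply ⟨ρ j z, hmem j z⟩)
  refine Lin.extension (g := π) (isHom_syzMap hg) ?_ (fun j x y hxy =>
    Subtype.ext (rTensor_injective inj₀ (congrArg Subtype.val hxy))) (fun j z => ?_)
    (fun j p => ?_) hM.2 hP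
  · intro i j l h r m
    refine inj l ((hπ l _).trans (Eq.trans ?_ (hf h r (π j m)).symm))
    rw [hπ, hρ, hρ, coe_syz_act, ← lTensor_rTensor_comm, eval_mul]
  · constructor
    · intro hz
      refine ⟨⟨LinearMap.rTensor _ e.symm.toLinearMap z.1, ?_⟩, Subtype.ext (he _ _)⟩
      rw [LinearMap.mem_ker, ← hρ, ← hπ, hz, map_zero]
    · rintro ⟨x, rfl⟩
      apply inj
      rw [hπ, hρ, coe_syzMap, he', map_zero]
      exact x.2
  · obtain ⟨x, hx⟩ := hM.1 (j + 1) (f j p)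
    refine ⟨⟨LinearMap.rTensor _ (g 0) x, ?_⟩, inj j ((hπ j _).trans ?_)⟩
    · rw [LinearMap.mem_ker, eval_rTensor hg, hx]
      exact (exact j _).mpr ⟨p, rfl⟩
    · exact (congrArg (M.eval (j + 1)) (he' _ _)).trans hx

end Mod
end GradedSystem

namespace GradedSystem
namespace Mod

variable {k A : Type} [Field k] [CommRing A] [Algebra k A] {S : GradedSystem k A}

/-- The iterated syzygy modules. -/
def iterSyz (T : S.Mod) : ℕ → S.Mod
  | 0 => T
  | i + 1 => (iterSyz T i).syz

theorem Lin.iterSyz {T : S.Mod} (h : ∀ m, Lin m T) (i m : ℕ) : Lin m (T.iterSyz i) := by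
  induction i generalizing m with
  | zero => exact h m
  | succ i ih => exact (ih (m + 1)).2

theorem finiteDimensional_iterSyz [FiniteDimensional k (S.piece 1)] {T : S.Mod}
    [FiniteDimensional k (T.C 0)] (i : ℕ) : FiniteDimensional k ((T.iterSyz i).C 0) := by
  induction i with
  | zero => assumption
  | succ i ih =>
    exact inferInstanceAs (FiniteDimensional k
      (LinearMap.ker ((T.iterSyz i).eval 1)))

theorem eval_zero_injective (hS : S.ConnectedOne) (M : S.Mod) : Injective (M.eval 0) := by
  have key : ∀ x : M.C 0 ⊗[k] S.piece 0, x = M.eval 0 x ⊗ₜ S.unit := by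
    intro x
    induction x with
    | zero => simp
    | add x y hx hy => rw [map_add, TensorProduct.add_tmul, ← hx, ← hy]
    | tmul m r =>
      have hr : (r : A) ∈ Submodule.span k {(1 : A)} := by
        rw [← show S.piece 0 = _ from hS]
        exact r.2
      obtain ⟨c, hc⟩ := Submodule.mem_span_singleton.mp hr
      have hr : r = c • S.unit := Subtype.ext hc.symm
      rw [hr, eval_tmul, map_smul, LinearMap.smul_apply, M.one_act, TensorProduct.tmul_smul,
        TensorProduct.smul_tmul']
  intro x y hxy
  rw [key x, key y, hxy]

end Mod

variable {k A : Type} [Field k] [CommRing A] [Algebra k A] {S : GradedSystem k A}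

theorem lTensor_mul_comm {V W : Type} [AddCommGroup V] [Module k V] [AddCommGroup W] [Module k W]
    (e : V →ₗ[k] W) (d : ℕ) (y : V ⊗[k] S.piece 1) (r : S.piece d) :
    LinearMap.lTensor W
      ((S.cast (add_comm 1 d)).toLinearMap ∘ₗ TensorProduct.lift (S.mulMap 1 d))
      (TensorProduct.assoc k W (S.piece 1) (S.piece d)
        (LinearMap.rTensor (S.piece 1) e y ⊗ₜ r)) =
      LinearMap.rTensor _ e (LinearMap.lTensor V (S.mul (rfl : d + 1 = d + 1) r) y) := by
  induction y with
  | zero => simp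
  | add x y hx hy => simp only [map_add, TensorProduct.add_tmul, hx, hy]
  | tmul v s =>
    simp only [LinearMap.rTensor_tmul, TensorProduct.assoc_tmul, LinearMap.lTensor_tmul]
    congr 1
    exact Subtype.ext (mul_comm _ _)

/-- `S` is Koszul as soon as the trivial module has a linear resolution. -/
theorem IsKoszul.of_lin (hS : S.ConnectedOne) [FiniteDimensional k (S.piece 1)]
    (T : S.Mod) (hT₀ : Module.finrank k (T.C 0) = 1) (hT : ∀ j, Subsingleton (T.C (j + 1)))
    (hlin : ∀ i, Mod.Lin i T) : S.IsKoszul := by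
  have : FiniteDimensional k (T.C 0) := Module.finite_of_finrank_eq_succ hT₀
  have hfin := fun i => Mod.finiteDimensional_iterSyz (T := T) i
  have hgen := fun i => (Mod.Lin.iterSyz hlin i 0).gen
  let n : ℕ → ℕ := fun i => Module.finrank k ((T.iterSyz i).C 0)
  let e : ∀ i, (T.iterSyz i).C 0 ≃ₗ[k] (Fin (n i) → k) := fun i =>
    (Module.finBasis k ((T.iterSyz i).C 0)).equivFun
  let incl : ∀ i, (T.iterSyz (i + 1)).C 0 →ₗ[k] (T.iterSyz i).C 0 ⊗[k] S.piece 1 := fun i =>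
    Submodule.subtype (LinearMap.ker ((T.iterSyz i).eval 1))
  let φ : ∀ i : ℕ, (Fin (n (i + 1)) → k) →ₗ[k] ((Fin (n i) → k) ⊗[k] S.piece 1) := fun i =>
    LinearMap.rTensor (S.piece 1) (e i).toLinearMap ∘ₗ incl i ∘ₗ (e (i + 1)).symm.toLinearMap
  let E : ∀ i d, (T.iterSyz i).C 0 ⊗[k] S.piece d → (Fin (n i) → k) ⊗[k] S.piece d := fun i d =>
    LinearMap.rTensor (S.piece d) (e i).toLinearMap
  have hEinj : ∀ i d, Injective (E i d) := fun i d => Mod.rTensor_injective (e i).injective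
  have hEsurj : ∀ i d, Surjective (E i d) := fun i d =>
    LinearMap.rTensor_surjective _ (e i).surjective
  have hE0 : ∀ i d, E i d 0 = 0 := fun i d => map_zero _
  let ev : ∀ i d, (T.iterSyz (i + 1)).C 0 ⊗[k] S.piece d →
      (T.iterSyz i).C 0 ⊗[k] S.piece (d + 1) := fun i d x =>
    (show LinearMap.ker ((T.iterSyz i).eval (d + 1)) from (T.iterSyz (i + 1)).eval d x).1
  have key : ∀ i d x, S.Dmap n φ i d (E (i + 1) d x) = E i (d + 1) (ev i d x) := by
    intro i d x
    induction x with
    | zero => simp only [E, ev, map_zero]; exact (hE0 i (d + 1)).symm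
    | add x y hx hy =>
      have h1 : E (i + 1) d (x + y) = E (i + 1) d x + E (i + 1) d y := map_add _ _ _
      have h2 : ev i d (x + y) = ev i d x + ev i d y := by
        simp only [ev, map_add]; rfl
      have h3 : E i (d + 1) (ev i d x + ev i d y) = E i (d + 1) (ev i d x) +
        E i (d + 1) (ev i d y) := map_add _ _ _
      rw [h1, map_add, hx, hy, h2, h3]
    | tmul m r =>
      have h1 : φ i (e (i + 1) m) = LinearMap.rTensor (S.piece 1) (e i).toLinearMap (incl i m) := by
        simp only [φ, LinearMap.comp_apply, LinearEquiv.coe_coe, LinearEquiv.symm_apply_apply]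
      have h2 := lTensor_mul_comm (e i).toLinearMap d (incl i m) r
      rw [← h1] at h2
      exact h2
  have ev_ker : ∀ i d x, (T.iterSyz i).eval (d + 1) (ev i d x) = 0 := fun i d x =>
    (show LinearMap.ker ((T.iterSyz i).eval (d + 1)) from (T.iterSyz (i + 1)).eval d x).2
  have ev_surj : ∀ i d y, (T.iterSyz i).eval (d + 1) y = 0 → ∃ x, ev i d x = y := by
    intro i d y hy
    obtain ⟨x, hx⟩ := hgen (i + 1) d ⟨y, hy⟩
    exact ⟨x, congrArg Subtype.val hx⟩
  refine ⟨hS, n, φ, hT₀, fun d y => ?_, fun i => ?_, fun i d => ?_⟩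
  · obtain ⟨y, rfl⟩ := hEsurj _ _ y
    obtain ⟨x, rfl⟩ := ev_surj 0 d y ((hT d).elim _ _)
    exact ⟨_, key 0 d x⟩
  · refine (injective_iff_map_eq_zero _).mpr fun z hz => ?_
    obtain ⟨x, rfl⟩ := hEsurj _ _ z
    rw [key] at hz
    have h1 : ev i 0 x = 0 := hEinj _ _ (hz.trans (hE0 _ _).symm)
    have h2 : (T.iterSyz (i + 1)).eval 0 x = 0 := Subtype.ext h1
    rw [Mod.eval_zero_injective hS _ (h2.trans (map_zero _).symm), hE0]
  · ext z
    obtain ⟨x, rfl⟩ := hEsurj _ _ z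
    rw [LinearMap.mem_range, LinearMap.mem_ker, key]
    constructor
    · rintro ⟨y, hy⟩
      obtain ⟨w, rfl⟩ := hEsurj _ _ y
      rw [key] at hy
      rw [← hEinj _ _ hy]
      have : ev i (d + 1) (ev (i + 1) d w) = 0 := congrArg Subtype.val (ev_ker (i + 1) d w)
      rw [this, hE0]
    · intro h
      have h1 : ev i (d + 1) x = 0 := hEinj _ _ (h.trans (hE0 _ _).symm)
      obtain ⟨w, hw⟩ := ev_surj (i + 1) d x (Subtype.ext h1)
      exact ⟨_, (key (i + 1) d w).trans (by rw [hw])⟩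

end GradedSystem

namespace GradedSystem

variable {k A : Type} [Field k] [CommRing A] [Algebra k A]

/-- A graded `S`-module of the form `⊕ X j / Y j`, for subspaces `Y j ≤ X j` of the ambient
algebra. -/
structure SubQuot (S : GradedSystem k A) where
  X : ℕ → Submodule k A
  Y : ℕ → Submodule k A
  le : ∀ j, Y j ≤ X j
  mul_mem_X : ∀ {i j : ℕ} {r x : A}, r ∈ S.piece i → x ∈ X j → r * x ∈ X (i + j)
  mul_mem_Y : ∀ {i j : ℕ} {r x : A}, r ∈ S.piece i → x ∈ Y j → r * x ∈ Y (i + j)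

namespace SubQuot

variable {S : GradedSystem k A}

/-- Multiplication by homogeneous elements on the numerators. -/
def mulX (Q : S.SubQuot) {i j l : ℕ} (h : i + j = l) : S.piece i →ₗ[k] Q.X j →ₗ[k] Q.X l :=
  LinearMap.mk₂ k (fun r x => ⟨(r : A) * (x : A), h ▸ Q.mul_mem_X r.2 x.2⟩)
    (fun r r' x => Subtype.ext (by simp [add_mul]))
    (fun c r x => Subtype.ext (by simp))
    (fun r x x' => Subtype.ext (by simp [mul_add]))
    (fun c r x => Subtype.ext (by simp))

/-- The graded module `⊕ X j / Y j`. -/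
def toMod (Q : S.SubQuot) : S.Mod where
  C j := Q.X j ⧸ (Q.Y j).submoduleOf (Q.X j)
  act {i j l} h := LinearMap.mk₂ k
    (fun r x => Submodule.mapQ _ _ (Q.mulX h r) (fun y hy => by
      subst h; exact Q.mul_mem_Y r.2 hy) x)
    (fun r r' x => by
      obtain ⟨x, rfl⟩ := Submodule.Quotient.mk_surjective _ x
      simp only [Submodule.mapQ_apply, map_add, LinearMap.add_apply, Submodule.Quotient.mk_add])
    (fun c r x => by
      obtain ⟨x, rfl⟩ := Submodule.Quotient.mk_surjective _ x
      simp only [Submodule.mapQ_apply, map_smul, LinearMap.smul_apply, Submodule.Quotient.mk_smul])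
    (fun r x x' => LinearMap.map_add _ _ _)
    (fun c r x => LinearMap.map_smul _ _ _)
  one_act {j} x := by
    obtain ⟨x, rfl⟩ := Submodule.Quotient.mk_surjective _ x
    exact congrArg Submodule.Quotient.mk (Subtype.ext (one_mul (x : A)))
  mul_act {i j p q l} h h' {t} h₁ h₂ r s x := by
    obtain ⟨x, rfl⟩ := Submodule.Quotient.mk_surjective _ x
    exact congrArg Submodule.Quotient.mk (Subtype.ext (mul_assoc (r : A) s x))

/-- The class of an element of `X j`. -/
def cls (Q : S.SubQuot) (j : ℕ) : Q.X j →ₗ[k] Q.toMod.C j := Submodule.mkQ _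

theorem cls_surjective (Q : S.SubQuot) (j : ℕ) : Surjective (Q.cls j) :=
  Submodule.mkQ_surjective _

theorem cls_eq_zero (Q : S.SubQuot) (j : ℕ) (x : Q.X j) : Q.cls j x = 0 ↔ (x : A) ∈ Q.Y j :=
  Submodule.Quotient.mk_eq_zero _

theorem cls_eq (Q : S.SubQuot) (j : ℕ) (x y : Q.X j) :
    Q.cls j x = Q.cls j y ↔ (x : A) - y ∈ Q.Y j :=
  Submodule.Quotient.eq _

/-- Multiplication by `a : A`, as a map of degree `e`. -/
def mulMapBy (P Q : S.SubQuot) (a : A) (e : ℕ)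
    (hX : ∀ j, ∀ x ∈ P.X j, a * x ∈ Q.X (j + e)) (hY : ∀ j, ∀ x ∈ P.Y j, a * x ∈ Q.Y (j + e))
    (j : ℕ) : P.toMod.C j →ₗ[k] Q.toMod.C (j + e) :=
  Submodule.mapQ _ _ ((LinearMap.mulLeft k a).restrict (hX j)) fun y hy => hY j y hy

theorem mulMapBy_cls (P Q : S.SubQuot) (a : A) (e : ℕ)
    (hX : ∀ j, ∀ x ∈ P.X j, a * x ∈ Q.X (j + e)) (hY : ∀ j, ∀ x ∈ P.Y j, a * x ∈ Q.Y (j + e))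
    (j : ℕ) (x : P.X j) :
    mulMapBy P Q a e hX hY j (P.cls j x) = Q.cls (j + e) ⟨a * x, hX j x x.2⟩ := rfl

theorem isHom_mulMapBy (P Q : S.SubQuot) (a : A) (e : ℕ)
    (hX : ∀ j, ∀ x ∈ P.X j, a * x ∈ Q.X (j + e)) (hY : ∀ j, ∀ x ∈ P.Y j, a * x ∈ Q.Y (j + e)) :
    Mod.IsHom e (mulMapBy P Q a e hX hY) := by
  intro i j l h r m
  obtain ⟨x, rfl⟩ := P.cls_surjective j m
  exact congrArg (Q.cls (l + e)) (Subtype.ext (mul_left_comm a (r : A) x))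

theorem mulMapBy_injective (P Q : S.SubQuot) (a : A) (e : ℕ)
    (hX : ∀ j, ∀ x ∈ P.X j, a * x ∈ Q.X (j + e)) (hY : ∀ j, ∀ x ∈ P.Y j, a * x ∈ Q.Y (j + e))
    (j : ℕ) (h : ∀ x ∈ P.X j, a * x ∈ Q.Y (j + e) → x ∈ P.Y j) :
    Injective (mulMapBy P Q a e hX hY j) := by
  refine (injective_iff_map_eq_zero _).mpr fun m hm => ?_
  obtain ⟨x, rfl⟩ := P.cls_surjective j m
  rw [mulMapBy_cls, cls_eq_zero] at hm
  exact (P.cls_eq_zero j x).mpr (h x x.2 hm)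

theorem mulMapBy_surjective (P Q : S.SubQuot) (a : A) (e : ℕ)
    (hX : ∀ j, ∀ x ∈ P.X j, a * x ∈ Q.X (j + e)) (hY : ∀ j, ∀ x ∈ P.Y j, a * x ∈ Q.Y (j + e))
    (j : ℕ) (h : ∀ y ∈ Q.X (j + e), ∃ x ∈ P.X j, y - a * x ∈ Q.Y (j + e)) :
    Surjective (mulMapBy P Q a e hX hY j) := by
  intro m
  obtain ⟨y, rfl⟩ := Q.cls_surjective _ m
  obtain ⟨x, hx, hxy⟩ := h y y.2
  refine ⟨P.cls j ⟨x, hx⟩, ?_⟩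
  rw [mulMapBy_cls]
  exact ((Q.cls_eq _ _ _).mpr hxy).symm

theorem lin_of_iso {i : ℕ} (P Q : S.SubQuot) (a : A)
    (hX : ∀ j, ∀ x ∈ P.X j, a * x ∈ Q.X j)
    (hY : ∀ j, ∀ x ∈ P.X j, a * x ∈ Q.Y j ↔ x ∈ P.Y j)
    (hs : ∀ j, ∀ y ∈ Q.X j, ∃ x ∈ P.X j, y - a * x ∈ Q.Y j)
    (h : Mod.Lin i P.toMod) : Mod.Lin i Q.toMod :=
  Mod.Lin.of_bijective
    (isHom_mulMapBy P Q a 0 hX fun j x hx => (hY j x (P.le j hx)).mpr hx)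
    (fun j => ⟨mulMapBy_injective P Q a 0 _ _ j fun x hx => (hY j x hx).mp,
      mulMapBy_surjective P Q a 0 _ _ j (hs j)⟩) h

/-- If `Y j ≤ Z j ≤ X j` and both `⊕ Z j / Y j` and `⊕ X j / Z j` are linear, then so is
`⊕ X j / Y j`. -/
theorem lin_of_filtration {i : ℕ} (Q' Q Q'' : S.SubQuot) (hY : Q'.Y = Q.Y) (hX : Q''.X = Q.X)
    (hZ : Q'.X = Q''.Y) (h' : Mod.Lin i Q'.toMod) (h'' : Mod.Lin i Q''.toMod) :
    Mod.Lin i Q.toMod := by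
  have hf : ∀ j, ∀ x ∈ Q'.X j, 1 * x ∈ Q.X (j + 0) := fun j x hx => by
    rw [one_mul, ← hX]; exact Q''.le j (hZ ▸ hx)
  have hf' : ∀ j, ∀ x ∈ Q'.Y j, 1 * x ∈ Q.Y (j + 0) := fun j x hx => by
    rw [one_mul, ← hY]; exact hx
  have hg : ∀ j, ∀ x ∈ Q.X j, 1 * x ∈ Q''.X (j + 0) := fun j x hx => by
    rw [one_mul, hX]; exact hx
  have hg' : ∀ j, ∀ x ∈ Q.Y j, 1 * x ∈ Q''.Y (j + 0) := fun j x hx => by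
    rw [one_mul, ← hZ]; exact Q'.le j (hY ▸ hx)
  refine Mod.Lin.extension (isHom_mulMapBy Q' Q 1 0 hf hf') (isHom_mulMapBy Q Q'' 1 0 hg hg')
    (fun j => mulMapBy_injective _ _ _ _ _ _ _ fun x _ hx => ?_) (fun j m => ?_)
    (fun j => mulMapBy_surjective _ _ _ _ _ _ _ fun y hy => ⟨y, hX ▸ hy, ?_⟩) h' h''
  · rwa [one_mul, ← hY] at hx
  · constructor
    · intro hm
      obtain ⟨x, rfl⟩ := Q.cls_surjective j m
      have hx : 1 * (x : A) ∈ Q''.Y j := (Q''.cls_eq_zero _ _).mp hm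
      rw [one_mul, ← hZ] at hx
      exact ⟨Q'.cls j ⟨x, hx⟩, congrArg (Q.cls j) (Subtype.ext (one_mul (x : A)))⟩
    · rintro ⟨m, rfl⟩
      obtain ⟨x, rfl⟩ := Q'.cls_surjective j m
      refine (Q''.cls_eq_zero _ _).mpr ?_
      change 1 * (1 * (x : A)) ∈ Q''.Y j
      rw [one_mul, one_mul, ← hZ]
      exact x.2
  · rw [one_mul, sub_self]; exact zero_mem _

/-- If `⊕ X j / Y j` is linear and multiplication by `a` identifies a linear module with
`⊕ Z (j+1) / Y (j+1)`, then `⊕ X j / Z j` is linear. -/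
theorem lin_of_quotient {i : ℕ} (P M N : S.SubQuot) (a : A) (hX : N.X = M.X)
    (hYZ : ∀ j, M.Y j ≤ N.Y j) (hY₀ : N.Y 0 ≤ M.Y 0)
    (ha : ∀ j, ∀ x ∈ P.X j, a * x ∈ N.Y (j + 1))
    (haY : ∀ j, ∀ x ∈ P.X j, a * x ∈ M.Y (j + 1) ↔ x ∈ P.Y j)
    (has : ∀ j, ∀ y ∈ N.Y (j + 1), ∃ x ∈ P.X j, y - a * x ∈ M.Y (j + 1))
    (hM : Mod.Lin i M.toMod) (hP : ∀ i', i = i' + 1 → Mod.Lin i' P.toMod) :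
    Mod.Lin i N.toMod := by
  have hg : ∀ j, ∀ x ∈ M.X j, 1 * x ∈ N.X (j + 0) := fun j x hx => by
    rw [one_mul, hX]; exact hx
  have hg' : ∀ j, ∀ x ∈ M.Y j, 1 * x ∈ N.Y (j + 0) := fun j x hx => by
    rw [one_mul]; exact hYZ j hx
  have hf : ∀ j, ∀ x ∈ P.X j, a * x ∈ M.X (j + 1) := fun j x hx => by
    rw [← hX]; exact N.le _ (ha j x hx)
  have hf' : ∀ j, ∀ x ∈ P.Y j, a * x ∈ M.Y (j + 1) := fun j x hx =>
    (haY j x (P.le j hx)).mpr hx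
  have surj : ∀ j, Surjective (mulMapBy M N 1 0 hg hg' j) := fun j =>
    mulMapBy_surjective _ _ _ _ _ _ _ fun y hy =>
      ⟨y, hX ▸ hy, by rw [one_mul, sub_self]; exact zero_mem _⟩
  cases i with
  | zero => exact Mod.Gen.of_surjective (isHom_mulMapBy M N 1 0 hg hg') surj hM
  | succ i =>
  refine Mod.Lin.quotient (isHom_mulMapBy P M a 1 hf hf') (isHom_mulMapBy M N 1 0 hg hg')
    (fun j => mulMapBy_injective _ _ _ _ _ _ _ fun x hx => (haY j x hx).mp) (fun j m => ?_)
    (mulMapBy_injective _ _ _ _ _ _ _ fun x _ hx => ?_)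
    surj hM (hP i rfl)
  · constructor
    · intro hm
      obtain ⟨y, rfl⟩ := M.cls_surjective (j + 1) m
      have hy : 1 * (y : A) ∈ N.Y (j + 1) := (N.cls_eq_zero _ _).mp hm
      rw [one_mul] at hy
      obtain ⟨x, hx, hxy⟩ := has j y hy
      exact ⟨P.cls j ⟨x, hx⟩, ((M.cls_eq _ _ _).mpr hxy).symm⟩
    · rintro ⟨m, rfl⟩
      obtain ⟨x, rfl⟩ := P.cls_surjective j m
      refine (N.cls_eq_zero _ _).mpr ?_
      change 1 * (a * (x : A)) ∈ N.Y (j + 1)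
      rw [one_mul]
      exact ha j x x.2
  · rw [one_mul] at hx; exact hY₀ hx

/-- The algebra as a module over itself. -/
def self (S : GradedSystem k A) : S.SubQuot where
  X := S.piece
  Y _ := ⊥
  le _ := bot_le
  mul_mem_X := S.mul_mem
  mul_mem_Y _ hx := by
    rw [Submodule.mem_bot] at hx
    rw [hx, mul_zero]; exact zero_mem _

theorem lin_self (hS : S.ConnectedOne) (i : ℕ) : Mod.Lin i (self S).toMod := by
  let u : (self S).X 0 := ⟨1, S.one_mem⟩
  have key : ∀ j, ∀ y : (self S).toMod.C 0 ⊗[k] S.piece j, ∃ r : (self S).X j,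
      y = (self S).cls 0 u ⊗ₜ (r : S.piece j) := by
    intro j y
    induction y with
    | zero => exact ⟨0, (TensorProduct.tmul_zero _ _).symm⟩
    | add x y hx hy =>
      obtain ⟨r, rfl⟩ := hx
      obtain ⟨s, rfl⟩ := hy
      exact ⟨r + s, (TensorProduct.tmul_add _ _ _).symm⟩
    | tmul m r =>
      obtain ⟨x, rfl⟩ := (self S).cls_surjective 0 m
      have hx : (x : A) ∈ Submodule.span k {(1 : A)} := by
        rw [← show S.piece 0 = _ from hS]
        exact x.2
      obtain ⟨c, hc⟩ := Submodule.mem_span_singleton.mp hx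
      refine ⟨c • r, ?_⟩
      rw [show x = c • u from Subtype.ext hc.symm, map_smul]
      exact TensorProduct.smul_tmul _ _ _
  have hcls : ∀ j (r : (self S).X j), (self S).toMod.eval j ((self S).cls 0 u ⊗ₜ r) =
      (self S).cls j r := fun j r =>
    congrArg ((self S).cls j) (Subtype.ext (mul_one (r : A)))
  have gen : (self S).toMod.Gen := by
    intro j m
    obtain ⟨r, rfl⟩ := (self S).cls_surjective j m
    exact ⟨_, hcls j r⟩
  cases i with
  | zero => exact gen
  | succ i =>
    refine ⟨gen, Mod.Lin.of_subsingleton i fun j => ?_⟩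
    refine subsingleton_of_forall_eq (0 : (self S).toMod.syz.C j) fun x => Subtype.ext ?_
    obtain ⟨r, hr⟩ := key (j + 1) x.1
    have h0 : (self S).toMod.eval (j + 1) x.1 = 0 := x.2
    rw [hr] at h0
    have h1 := ((self S).cls_eq_zero (j + 1) r).mp ((hcls (j + 1) r).symm.trans h0)
    rw [hr, show r = 0 from Subtype.ext ((Submodule.mem_bot k).mp h1)]
    exact TensorProduct.tmul_zero _ _

end SubQuot
end GradedSystem

namespace Curve

variable (C : Curve)

theorem deg_add (D E : C.Div) : C.deg (D + E) = C.deg D + C.deg E :=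
  Finsupp.sum_add_index' (fun _ => rfl) (fun _ _ _ => rfl)

theorem deg_sub (D E : C.Div) : C.deg (D - E) = C.deg D - C.deg E :=
  Finsupp.sum_sub_index (fun _ _ _ => rfl)

theorem deg_zero : C.deg 0 = 0 := Finsupp.sum_zero_index

theorem deg_nsmul (j : ℕ) (D : C.Div) : C.deg (j • D) = j * C.deg D := by
  induction j with
  | zero => simp [deg_zero]
  | succ j ih => rw [succ_nsmul, deg_add, ih]; push_cast; ring

theorem deg_pt (P : C.Point) : C.deg (C.pt P) = 1 := Finsupp.sum_single_index rfl

theorem deg_divOfFinset (T : Finset C.Point) : C.deg (C.divOfFinset T) = T.card := by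
  classical
  induction T using Finset.induction_on with
  | empty => simp [PreCurve.divOfFinset, deg_zero]
  | insert P T hP ih =>
    rw [PreCurve.divOfFinset, Finset.sum_insert hP, deg_add, deg_pt, Finset.card_insert_of_notMem hP]
    change 1 + C.deg (C.divOfFinset T) = _
    rw [ih]; push_cast; ring

theorem divOfFinset_apply [DecidableEq C.Point] (T : Finset C.Point) (P : C.Point) :
    C.divOfFinset T P = if P ∈ T then 1 else 0 := by
  rw [PreCurve.divOfFinset, Finsupp.finsetSum_apply]
  simp [PreCurve.pt, Finsupp.single_apply]

theorem divOfFinset_insert [DecidableEq C.Point] {T : Finset C.Point} {P : C.Point} (hP : P ∉ T) :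
    C.divOfFinset (insert P T) = C.divOfFinset T + C.pt P := by
  rw [PreCurve.divOfFinset, Finset.sum_insert hP, add_comm]; rfl

theorem divOfFinset_singleton (P : C.Point) : C.divOfFinset {P} = C.pt P :=
  Finset.sum_singleton _ _

theorem divOfFinset_empty : C.divOfFinset ∅ = 0 := rfl

theorem divOfFinset_union [DecidableEq C.Point] {S T : Finset C.Point} (h : Disjoint S T) :
    C.divOfFinset (S ∪ T) = C.divOfFinset S + C.divOfFinset T :=
  Finset.sum_union h

theorem divOfFinset_mono {S T : Finset C.Point} (h : S ⊆ T) (P : C.Point) :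
    C.divOfFinset S P ≤ C.divOfFinset T P := by
  classical
  rw [divOfFinset_apply, divOfFinset_apply]
  by_cases hS : P ∈ S
  · simp [hS, h hS]
  · rw [if_neg hS]; split_ifs <;> norm_num

instance (D : C.Div) : FiniteDimensional ℂ (C.H0 D) := C.finiteDim D

theorem h0_mono {D E : C.Div} (h : ∀ P, D P ≤ E P) : C.h0 D ≤ C.h0 E :=
  Submodule.finrank_mono (C.H0_mono h)

theorem h0_le_sub_pt (D : C.Div) (P : C.Point) : C.h0 D ≤ C.h0 (D - C.pt P) + 1 := by
  classical
  have h1 := C.riemann_roch D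
  have h2 := C.riemann_roch (D - C.pt P)
  have h3 : C.h0 (C.K - D) ≤ C.h0 (C.K - (D - C.pt P)) := C.h0_mono fun Q => by
    have : 0 ≤ C.pt P Q := by
      rw [PreCurve.pt, Finsupp.single_apply]; split_ifs <;> norm_num
    simp only [Finsupp.sub_apply]; omega
  rw [deg_sub, deg_pt] at h2
  omega

theorem h0_le_sub_divOfFinset (D : C.Div) (T : Finset C.Point) :
    C.h0 D ≤ C.h0 (D - C.divOfFinset T) + T.card := by
  classical
  induction T using Finset.induction_on with
  | empty => simp [divOfFinset_empty]
  | insert P T hP ih =>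
    have := C.h0_le_sub_pt (D - C.divOfFinset T) P
    rw [divOfFinset_insert C hP, Finset.card_insert_of_notMem hP, ← sub_sub]
    omega

theorem ord_one (P : C.Point) : C.ord P 1 = 0 := by
  simpa using C.ord_algebraMap P 1 one_ne_zero

theorem mem_H0_of_ne_zero {D : C.Div} {f : C.F} (hf : f ≠ 0) :
    f ∈ C.H0 D ↔ ∀ P, 0 ≤ C.ord P f + D P :=
  C.mem_H0.trans (or_iff_right hf)

theorem one_mem_H0 {D : C.Div} (hD : ∀ P, 0 ≤ D P) : (1 : C.F) ∈ C.H0 D :=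
  (C.mem_H0_of_ne_zero one_ne_zero).mpr fun P => by rw [ord_one]; simpa using hD P

theorem H0_zero : C.H0 0 = Submodule.span ℂ {(1 : C.F)} := by
  refine (Submodule.eq_of_le_of_finrank_le ?_ ?_).symm
  · rw [Submodule.span_singleton_le_iff_mem]
    exact C.one_mem_H0 fun P => le_rfl
  · rw [finrank_span_singleton one_ne_zero]
    exact C.h0_triv.le

theorem mem_H0_sub_pt {D : C.Div} {P : C.Point} {f : C.F} (hf : f ≠ 0) :
    f ∈ C.H0 (D - C.pt P) ↔ f ∈ C.H0 D ∧ 1 ≤ C.ord P f + D P := by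
  classical
  rw [C.mem_H0_of_ne_zero hf, C.mem_H0_of_ne_zero hf]
  have hpt : ∀ Q, C.pt P Q = if P = Q then 1 else 0 := fun Q => Finsupp.single_apply
  simp only [Finsupp.sub_apply, hpt]
  constructor
  · intro h
    refine ⟨fun Q => ?_, ?_⟩
    · have := h Q; split_ifs at this <;> omega
    · have := h P; rw [if_pos rfl] at this; omega
  · rintro ⟨h, h1⟩ Q
    have := h Q
    split_ifs with hQ
    · subst hQ; omega
    · omega

/-- A section of `E` not vanishing at `P` has order exactly `-E P` there. -/
theorem ord_eq_of_notMem {E : C.Div} {a : C.F} {P : C.Point} (ha : a ∈ C.H0 E)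
    (h : a ∉ C.H0 (E - C.pt P)) : a ≠ 0 ∧ C.ord P a = - E P := by
  have h0 : a ≠ 0 := by
    rintro rfl
    exact h (zero_mem _)
  refine ⟨h0, ?_⟩
  have h1 := (C.mem_H0_of_ne_zero h0).mp ha P
  have h2 := mt (fun h' => (C.mem_H0_sub_pt (P := P) h0).mpr ⟨ha, h'⟩) h
  omega

theorem mul_mem_sub_divOfFinset_iff {E G : C.Div} {a x : C.F} {T : Finset C.Point}
    (ha : a ∈ C.H0 E) (ha0 : a ≠ 0) (haT : ∀ P ∈ T, a ∉ C.H0 (E - C.pt P)) (hx : x ∈ C.H0 G) :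
    a * x ∈ C.H0 (G + E - C.divOfFinset T) ↔ x ∈ C.H0 (G - C.divOfFinset T) := by
  classical
  rcases eq_or_ne x 0 with rfl | hx0
  · simp only [mul_zero, zero_mem]
  rw [C.mem_H0_of_ne_zero hx0, C.mem_H0_of_ne_zero (mul_ne_zero ha0 hx0)]
  refine forall_congr' fun P => ?_
  have h1 := (C.mem_H0_of_ne_zero hx0).mp hx P
  have h2 := (C.mem_H0_of_ne_zero ha0).mp ha P
  simp only [Finsupp.sub_apply, Finsupp.add_apply, divOfFinset_apply, C.ord_mul P a x ha0 hx0]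
  split_ifs with hP
  · have := (C.ord_eq_of_notMem ha (haT P hP)).2
    constructor <;> intro <;> omega
  · constructor <;> intro <;> omega

/-- The image of a space of functions under multiplication by `a`. -/
def mulImage (a : C.F) (V : Submodule ℂ C.F) : Submodule ℂ C.F := V.map (LinearMap.mulLeft ℂ a)

theorem finrank_mulImage {a : C.F} (ha : a ≠ 0) (V : Submodule ℂ C.F) :
    Module.finrank ℂ (C.mulImage a V) = Module.finrank ℂ V :=
  (Submodule.equivMapOfInjective (LinearMap.mulLeft ℂ a) (mul_right_injective₀ ha) V).symm.finrank_eq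

theorem mul_mem_H0_of_eq {D E G : C.Div} {f g : C.F} (hf : f ∈ C.H0 D) (hg : g ∈ C.H0 E)
    (h : D + E = G) : f * g ∈ C.H0 G :=
  h ▸ C.mul_mem_H0 hf hg

theorem exists_sub_mul_mem {E G : C.Div} {a : C.F} {T : Finset C.Point}
    (ha : a ∈ C.H0 E) (ha0 : a ≠ 0) (haT : ∀ P ∈ T, a ∉ C.H0 (E - C.pt P))
    (h : C.h0 (G + E) + C.h0 (G - C.divOfFinset T) ≤ C.h0 G + C.h0 (G + E - C.divOfFinset T))
    {y : C.F} (hy : y ∈ C.H0 (G + E)) :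
    ∃ x ∈ C.H0 G, y - a * x ∈ C.H0 (G + E - C.divOfFinset T) := by
  set U := C.mulImage a (C.H0 G)
  set V := C.H0 (G + E - C.divOfFinset T)
  have : FiniteDimensional ℂ U := by
    unfold U mulImage; infer_instance
  have hU : U ≤ C.H0 (G + E) := by
    rintro _ ⟨x, hx, rfl⟩
    exact C.mul_mem_H0_of_eq ha hx (add_comm _ _)
  have hV : V ≤ C.H0 (G + E) := C.H0_mono fun P => by
    classical
    simp only [Finsupp.sub_apply, divOfFinset_apply]
    split_ifs <;> omega
  have hUV : U ⊓ V ≤ C.mulImage a (C.H0 (G - C.divOfFinset T)) := by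
    rintro _ ⟨⟨x, hx, rfl⟩, hx'⟩
    exact ⟨x, (C.mul_mem_sub_divOfFinset_iff ha ha0 haT hx).mp hx', rfl⟩
  have h1 := Submodule.finrank_sup_add_finrank_inf_eq U V
  have h2 : Module.finrank ℂ U = C.h0 G := C.finrank_mulImage ha0 _
  have : FiniteDimensional ℂ (C.mulImage a (C.H0 (G - C.divOfFinset T))) := by
    unfold mulImage; infer_instance
  have h3 := Submodule.finrank_mono hUV
  rw [C.finrank_mulImage ha0] at h3
  have h4 : U ⊔ V = C.H0 (G + E) := Submodule.eq_of_le_of_finrank_le (sup_le hU hV) (by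
    simp only [PreCurve.h0, V] at *; omega)
  rw [← h4] at hy
  obtain ⟨_, ⟨x, hx, rfl⟩, v, hv, rfl⟩ := Submodule.mem_sup.mp hy
  exact ⟨x, hx, by simpa using hv⟩

theorem exists_mul_eq_of_pencil {E G : C.Div} {a b x y : C.F} (ha : a ∈ C.H0 E) (hb : b ∈ C.H0 E)
    (ha0 : a ≠ 0) (hb0 : b ≠ 0) (hab : ∀ P, a ∉ C.H0 (E - C.pt P) ∨ b ∉ C.H0 (E - C.pt P))
    (hx : x ∈ C.H0 G) (hy : y ∈ C.H0 G) (h : a * x = b * y) :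
    ∃ c ∈ C.H0 (G - E), b * c = x ∧ a * c = y := by
  have hc : a * (x / b) = y := by field_simp; rw [h]
  refine ⟨x / b, ?_, by field_simp, hc⟩
  rcases eq_or_ne (x / b) 0 with h0 | h0
  · rw [h0]; exact zero_mem _
  rw [C.mem_H0_of_ne_zero h0]
  intro P
  have hx' : b * (x / b) = x := by field_simp
  generalize x / b = c at *
  subst hx' hc
  have h1 := (C.mem_H0_of_ne_zero (mul_ne_zero hb0 h0)).mp hx P
  have h2 := (C.mem_H0_of_ne_zero (mul_ne_zero ha0 h0)).mp hy P
  rw [C.ord_mul P _ _ hb0 h0] at h1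
  rw [C.ord_mul P _ _ ha0 h0] at h2
  rw [Finsupp.sub_apply]
  rcases hab P with h | h
  · have := (C.ord_eq_of_notMem ha h).2; omega
  · have := (C.ord_eq_of_notMem hb h).2; omega

theorem exists_add_mul_of_pencil {E G : C.Div} {a b : C.F} (ha : a ∈ C.H0 E) (hb : b ∈ C.H0 E)
    (ha0 : a ≠ 0) (hb0 : b ≠ 0) (hab : ∀ P, a ∉ C.H0 (E - C.pt P) ∨ b ∉ C.H0 (E - C.pt P))
    (h : C.h0 (G + E) + C.h0 (G - E) ≤ 2 * C.h0 G) {z : C.F} (hz : z ∈ C.H0 (G + E)) :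
    ∃ x ∈ C.H0 G, ∃ y ∈ C.H0 G, a * x + b * y = z := by
  set U := C.mulImage a (C.H0 G)
  set V := C.mulImage b (C.H0 G)
  set W := C.mulImage a (C.mulImage b (C.H0 (G - E)))
  have : FiniteDimensional ℂ U := by
    unfold U mulImage; infer_instance
  have : FiniteDimensional ℂ V := by
    unfold V mulImage; infer_instance
  have : FiniteDimensional ℂ W := by
    unfold W mulImage; infer_instance
  have hU : U ≤ C.H0 (G + E) := by
    rintro _ ⟨x, hx, rfl⟩
    exact C.mul_mem_H0_of_eq ha hx (add_comm _ _)
  have hV : V ≤ C.H0 (G + E) := by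
    rintro _ ⟨x, hx, rfl⟩
    exact C.mul_mem_H0_of_eq hb hx (add_comm _ _)
  have hUV : U ⊓ V ≤ W := by
    rintro _ ⟨⟨x, hx, rfl⟩, y, hy, hxy⟩
    obtain ⟨c, hc, hc', -⟩ := C.exists_mul_eq_of_pencil ha hb ha0 hb0 hab hx hy hxy.symm
    exact ⟨x, ⟨c, hc, hc'⟩, rfl⟩
  have h1 := Submodule.finrank_sup_add_finrank_inf_eq U V
  have h2 : Module.finrank ℂ U = C.h0 G := C.finrank_mulImage ha0 _
  have h2' : Module.finrank ℂ V = C.h0 G := C.finrank_mulImage hb0 _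
  have h3 := Submodule.finrank_mono hUV
  have h3' : Module.finrank ℂ W = C.h0 (G - E) := by
    rw [C.finrank_mulImage ha0, C.finrank_mulImage hb0]; rfl
  have h4 : U ⊔ V = C.H0 (G + E) := Submodule.eq_of_le_of_finrank_le (sup_le hU hV) (by
    simp only [PreCurve.h0] at *; omega)
  rw [← h4] at hz
  obtain ⟨_, ⟨x, hx, rfl⟩, _, ⟨y, hy, rfl⟩, rfl⟩ := Submodule.mem_sup.mp hz
  exact ⟨x, hx, y, hy, rfl⟩

theorem h0_add_ge {E G : C.Div} {f : C.F} (hf : f ∈ C.H0 E) (hf0 : f ≠ 0) :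
    C.h0 G ≤ C.h0 (E + G) := by
  have h : C.mulImage f (C.H0 G) ≤ C.H0 (E + G) := by
    rintro _ ⟨x, hx, rfl⟩
    exact C.mul_mem_H0 hf hx
  have := Submodule.finrank_mono h
  rwa [C.finrank_mulImage hf0] at this

theorem H0_neg_eq_bot {E : C.Div} (h : 2 ≤ C.h0 E) : C.H0 (-E) = ⊥ := by
  rw [Submodule.eq_bot_iff]
  intro f hf
  by_contra hf0
  have := C.h0_add_ge (G := E) hf hf0
  rw [neg_add_cancel, C.h0_triv] at this
  omega

theorem h0_neg {E : C.Div} (h : 2 ≤ C.h0 E) : C.h0 (-E) = 0 := by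
  rw [PreCurve.h0, C.H0_neg_eq_bot h, finrank_bot]

theorem H0_neg_divOfFinset {T : Finset C.Point} (hT : T.Nonempty) :
    C.H0 (-C.divOfFinset T) = ⊥ := by
  classical
  rw [Submodule.eq_bot_iff]
  intro f hf
  by_contra hf0
  have h0 : f ∈ C.H0 0 := C.H0_mono (fun P => by
    simp only [Finsupp.neg_apply, divOfFinset_apply, Finsupp.coe_zero, Pi.zero_apply]
    split_ifs <;> norm_num) hf
  rw [H0_zero] at h0
  obtain ⟨c, rfl⟩ := Submodule.mem_span_singleton.mp h0
  have hc : c ≠ 0 := by rintro rfl; simp at hf0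
  have h1 : (1 : C.F) ∈ C.H0 (-C.divOfFinset T) := (Submodule.smul_mem_iff _ hc).mp hf
  obtain ⟨P, hP⟩ := hT
  have := (C.mem_H0_of_ne_zero one_ne_zero).mp h1 P
  rw [ord_one, Finsupp.neg_apply, divOfFinset_apply, if_pos hP] at this
  omega

theorem h0_eq (D : C.Div) : (C.h0 D : ℤ) = C.deg D + 1 - C.genus + C.h1 D := by
  have := C.riemann_roch D
  rw [h1]; omega

theorem h1_add_eq_zero {E G : C.Div} {f : C.F} (hf : f ∈ C.H0 E) (hf0 : f ≠ 0)
    (h : C.h1 G = 0) : C.h1 (G + E) = 0 := by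
  have := C.h0_add_ge (G := C.K - (G + E)) hf hf0
  rw [show E + (C.K - (G + E)) = C.K - G by abel] at this
  rw [h1] at *
  omega

theorem exists_notMem_of_basePointFree {D : C.Div} (h : C.BasePointFree D) (T : Finset C.Point) :
    ∃ u ∈ C.H0 D, ∀ P ∈ T, u ∉ C.H0 (D - C.pt P) := by
  classical
  let W : C.Point → Subspace ℂ (C.H0 D) := fun P => (C.H0 (D - C.pt P)).comap (C.H0 D).subtype
  have hW : ⊤ ∉ T.image W := by
    intro hT
    obtain ⟨P, -, hP⟩ := Finset.mem_image.mp hT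
    have h1 : C.H0 D ≤ C.H0 (D - C.pt P) := fun x hx => by
      have : (⟨x, hx⟩ : C.H0 D) ∈ W P := hP ▸ Submodule.mem_top
      exact this
    have h2 := Submodule.finrank_mono h1
    have h3 := h P
    simp only [PreCurve.h0] at h3
    omega
  obtain ⟨u, hu⟩ := (Set.ne_univ_iff_exists_notMem _).mp (Subspace.biUnion_ne_univ_of_top_notMem hW)
  refine ⟨u, u.2, fun P hP hu' => hu ?_⟩
  exact Set.mem_biUnion (Finset.mem_coe.mpr (Finset.mem_image_of_mem W hP)) hu'

theorem exists_pencil {E : C.Div} (h : C.IsBPFPencil E) :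
    ∃ a ∈ C.H0 E, ∃ b ∈ C.H0 E, a ≠ 0 ∧ b ≠ 0 ∧
      ∀ P, a ∉ C.H0 (E - C.pt P) ∨ b ∉ C.H0 (E - C.pt P) := by
  let B := Module.finBasisOfFinrankEq ℂ (C.H0 E) h.2
  refine ⟨B 0, (B 0).2, B 1, (B 1).2, by simpa using B.ne_zero 0, by simpa using B.ne_zero 1,
    fun P => ?_⟩
  by_contra! hP
  have : C.H0 E ≤ C.H0 (E - C.pt P) := by
    intro x hx
    have := B.sum_repr ⟨x, hx⟩
    rw [Fin.sum_univ_two] at this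
    have := congrArg Subtype.val this
    simp only [Submodule.coe_add, Submodule.coe_smul] at this
    rw [← this]
    exact add_mem (Submodule.smul_mem _ _ hP.1) (Submodule.smul_mem _ _ hP.2)
  have h1 := Submodule.finrank_mono this
  have h2 := h.1 P
  simp only [PreCurve.h0] at h2
  omega

/-- Numerical consequences of a decomposition of `L` as the sum of a reduced base-point-free
divisor and a base-point-free pencil; sets of at most `n + 1` points of the divisor impose
independent conditions on `L`. -/
structure PencilDecomposition (L : C.Div) (Pts : Finset C.Point) (n : ℕ) : Prop where
  one_le : 1 ≤ n
  lt_card : n < Pts.card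
  card_le : Pts.card ≤ 2 * n
  basePointFree : C.BasePointFree (C.divOfFinset Pts)
  pencil : C.IsBPFPencil (L - C.divOfFinset Pts)
  h0_sub : ∀ T ⊆ Pts, T.card ≤ n + 1 → C.h0 (L - C.divOfFinset T) + T.card = n + 3
  h0_nsmul_sub : ∀ j, ∀ T ⊆ Pts,
    C.h0 ((j + 2) • L - C.divOfFinset T) + T.card = C.h0 ((j + 2) • L)
  h0_pencil : ∀ j : ℕ, C.h0 (j • L + (L - C.divOfFinset Pts)) +
    C.h0 (j • L - (L - C.divOfFinset Pts)) ≤ 2 * C.h0 (j • L)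
  h0_divisor : ∀ j : ℕ, C.h0 ((j + 1) • L + C.divOfFinset Pts) +
    C.h0 ((j + 1) • L - C.divOfFinset Pts) ≤ 2 * C.h0 ((j + 1) • L)

variable {C}

theorem h1_add_nsmul_eq_zero {G L : C.Div} {f : C.F} (hf : f ∈ C.H0 L) (hf0 : f ≠ 0)
    (h : C.h1 G = 0) (j : ℕ) : C.h1 (G + j • L) = 0 := by
  induction j with
  | zero => simpa using h
  | succ j ih => rw [succ_nsmul, ← add_assoc]; exact C.h1_add_eq_zero hf hf0 ih

theorem PencilDecomposition.of_curve {L : C.Div} (hdegL : (C.genus : ℤ) + 3 ≤ C.deg L)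
    {Pts : Finset C.Point}
    (hcard : (Pts.card : ℤ) = C.deg L - C.genus - 1 + 2 * C.h1 L)
    (hDbpf : C.BasePointFree (C.divOfFinset Pts))
    (hDdim : (C.h0 (C.divOfFinset Pts) : ℤ) = C.deg L - 2 * C.genus + 4 * C.h1 L)
    (hLD : C.IsBPFPencil (L - C.divOfFinset Pts))
    (h1LD : C.h1 (L + C.divOfFinset Pts) = 0) (h1LLD : C.h1 (2 • L - C.divOfFinset Pts) = 0)
    (hind : ∀ s : Finset C.Point, s ⊆ Pts → s.card = C.h1 L →
      C.h0 (C.K - L + C.divOfFinset Pts - C.divOfFinset s) + C.h1 L =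
        C.h0 (C.K - L + C.divOfFinset Pts)) :
    C.PencilDecomposition L Pts (Pts.card - C.h1 L - 1) := by
  classical
  set D := C.divOfFinset Pts with hD
  have hdegD : C.deg D = Pts.card := C.deg_divOfFinset Pts
  have hone : ∀ {T : Finset C.Point}, (1 : C.F) ∈ C.H0 (C.divOfFinset T) := fun {T} =>
    C.one_mem_H0 fun P => by rw [divOfFinset_apply]; split_ifs <;> norm_num
  have hL := C.h0_eq L
  have hLD0 := C.h0_eq (L - D)
  rw [hLD.2, deg_sub, hdegD] at hLD0
  obtain ⟨f, hf, hf0⟩ : ∃ f ∈ C.H0 L, f ≠ 0 := by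
    refine (Submodule.ne_bot_iff _).mp fun h => ?_
    have : C.h0 L = 0 := by rw [PreCurve.h0, h, finrank_bot]
    omega
  have hsplit : ∀ T ⊆ Pts, D = C.divOfFinset T + C.divOfFinset (Pts \ T) := fun T hT => by
    rw [hD, ← divOfFinset_union C Finset.disjoint_sdiff, Finset.union_sdiff_of_subset hT]
  have hsub : ∀ j : ℕ, ∀ T ⊆ Pts, C.h1 ((j + 2) • L - C.divOfFinset T) = 0 := fun j T hT => by
    have h1 := C.h1_add_eq_zero (hone (T := Pts \ T)) one_ne_zero h1LLD
    have h2 := h1_add_nsmul_eq_zero hf hf0 h1 j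
    rw [hsplit T hT] at h2
    rw [← h2]
    congr 1
    module
  have hsub0 : ∀ j : ℕ, C.h1 ((j + 2) • L) = 0 := fun j => by
    simpa [divOfFinset_empty] using hsub j ∅ (Finset.empty_subset _)
  have hadd : ∀ j : ℕ, C.h1 ((j + 1) • L + D) = 0 := fun j => by
    rw [← h1_add_nsmul_eq_zero hf hf0 h1LD j]
    congr 1
    module
  have hlow : ∀ T ⊆ Pts, T.card = Pts.card - C.h1 L → C.h0 (L - C.divOfFinset T) = 2 := by
    intro T hT hTc
    have h1 := hind (Pts \ T) Finset.sdiff_subset (by rw [Finset.card_sdiff_of_subset hT]; omega)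
    have h2 := C.h0_eq (L - C.divOfFinset T)
    rw [deg_sub, deg_divOfFinset] at h2
    have h3 : C.K - L + D - C.divOfFinset (Pts \ T) = C.K - (L - C.divOfFinset T) := by
      rw [hsplit T hT]; abel
    have h4 : C.K - L + D = C.K - (L - D) := by abel
    rw [h3, h4] at h1
    change C.h1 (L - C.divOfFinset T) + C.h1 L = C.h1 (L - D) at h1
    omega
  refine ⟨by omega, by omega, by omega, hDbpf, hLD, ?_, ?_, ?_, ?_⟩
  · intro T hT hTc
    obtain ⟨T', hTT', hT', hT'c⟩ :=
      Finset.exists_subsuperset_card_eq (n := Pts.card - C.h1 L) hT (by omega) (by omega)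
    have h1 := hlow T' hT' hT'c
    have h2 := C.h0_le_sub_divOfFinset L T
    have h3 := C.h0_le_sub_divOfFinset (L - C.divOfFinset T) (T' \ T)
    rw [sub_sub, ← divOfFinset_union C Finset.disjoint_sdiff, Finset.union_sdiff_of_subset hTT', h1,
      Finset.card_sdiff_of_subset hTT'] at h3
    omega
  · intro j T hT
    have h1 := C.h0_eq ((j + 2) • L - C.divOfFinset T)
    have h2 := C.h0_eq ((j + 2) • L)
    rw [hsub j T hT, deg_sub, deg_divOfFinset] at h1
    rw [hsub0] at h2
    omega
  · intro j
    rw [← hD]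
    match j with
    | 0 =>
      have := C.h0_neg hLD.2.ge
      simp only [zero_smul, zero_add, zero_sub, this, hLD.2, C.h0_triv]
      norm_num
    | 1 =>
      have h1 := C.h0_eq (2 • L - D)
      rw [h1LLD, deg_sub, deg_nsmul, hdegD] at h1
      rw [show 1 • L + (L - D) = 2 • L - D by module, show 1 • L - (L - D) = D by module, one_smul]
      push_cast at h1
      omega
    | j + 2 =>
      have h1 := C.h0_eq ((j + 1 + 2) • L - D)
      have h2 := C.h0_eq ((j + 1) • L + D)
      have h3 := C.h0_eq ((j + 2) • L)
      rw [hsub _ _ subset_rfl, deg_sub, deg_nsmul, hdegD] at h1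
      rw [hadd, deg_add, deg_nsmul, hdegD] at h2
      rw [hsub0, deg_nsmul] at h3
      rw [show (j + 2) • L + (L - D) = (j + 1 + 2) • L - D by module,
        show (j + 2) • L - (L - D) = (j + 1) • L + D by module]
      push_cast at h1 h2 h3
      zify
      linarith
  · intro j
    rw [← hD]
    have h2 := C.h0_eq ((j + 1) • L + D)
    rw [hadd, deg_add, deg_nsmul, hdegD] at h2
    match j with
    | 0 =>
      simp only [zero_add, one_smul] at *
      push_cast at h2
      rw [hLD.2]
      omega
    | j + 1 =>
      have h1 := C.h0_eq ((j + 2) • L - D)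
      have h3 := C.h0_eq ((j + 2) • L)
      rw [hsub _ _ subset_rfl, deg_sub, deg_nsmul, hdegD] at h1
      rw [hsub0, deg_nsmul] at h3
      rw [show j + 1 + 1 = j + 2 from rfl] at *
      push_cast at h1 h2 h3
      zify
      linarith

end Curve

namespace GradedSystem

variable {k A : Type} [Field k] [CommRing A] [Algebra k A]

/-- A family of subspaces of the ambient algebra stable under multiplication by homogeneous
elements. -/
class Stable (S : GradedSystem k A) (X : ℕ → Submodule k A) : Prop where
  mul_mem : ∀ {i j : ℕ} {r x : A}, r ∈ S.piece i → x ∈ X j → r * x ∈ X (i + j)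

variable (S : GradedSystem k A)

instance : S.Stable S.piece := ⟨S.mul_mem⟩

instance : S.Stable ⊥ := ⟨fun {i j r x} _ hx => by
  rw [Pi.bot_apply, Submodule.mem_bot] at *
  rw [hx, mul_zero]⟩

/-- Multiplication of a family of subspaces by an element. -/
def scale (a : A) (X : ℕ → Submodule k A) (j : ℕ) : Submodule k A :=
  (X j).map (LinearMap.mulLeft k a)

instance (a : A) (X : ℕ → Submodule k A) [S.Stable X] : S.Stable (scale a X) :=
  ⟨fun {i j r x} hr hx => by
    obtain ⟨x, hx, rfl⟩ := hx
    exact ⟨r * x, Stable.mul_mem hr hx, mul_left_comm a r x⟩⟩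

/-- The shift of a family of subspaces, with a prescribed component in degree zero. -/
def cons (G : Submodule k A) (X : ℕ → Submodule k A) : ℕ → Submodule k A
  | 0 => G
  | j + 1 => X j

variable {S} in
theorem Stable.cons (hS : S.ConnectedOne) {G : Submodule k A} {X : ℕ → Submodule k A} [S.Stable X]
    (h : ∀ {i : ℕ} {r x : A}, r ∈ S.piece (i + 1) → x ∈ G → r * x ∈ X i) :
    S.Stable (cons G X) := ⟨fun {i j r x} hr hx => by
  cases i with
  | zero =>
    rw [hS, Submodule.mem_span_singleton] at hr
    obtain ⟨c, rfl⟩ := hr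
    rw [smul_one_mul, zero_add]
    exact Submodule.smul_mem _ c hx
  | succ i =>
    cases j with
    | zero => exact h hr hx
    | succ j =>
      have hx : x ∈ X j := hx
      exact Stable.mul_mem (X := X) hr hx⟩

instance (X : ℕ → Submodule k A) [S.Stable X] : S.Stable (cons ⊥ X) :=
  ⟨fun {i j r x} hr hx => by
    cases j with
    | zero =>
      rw [(Submodule.mem_bot k).mp hx, mul_zero]
      exact zero_mem _
    | succ j =>
      have hx : x ∈ X j := hx
      exact Stable.mul_mem (X := X) hr hx⟩

variable {S} in
/-- The subquotient `⊕ X j / Y j` attached to stable families `Y j ≤ X j`. -/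
def SubQuot.of (X Y : ℕ → Submodule k A) [S.Stable X] [S.Stable Y] (h : ∀ j, Y j ≤ X j) :
    S.SubQuot where
  X := X
  Y := Y
  le := h
  mul_mem_X := Stable.mul_mem
  mul_mem_Y := Stable.mul_mem

end GradedSystem

namespace Curve

open GradedSystem

variable (C : Curve)

theorem connectedOne_RL (L : C.Div) : (C.RL L).ConnectedOne := by
  change C.H0 (0 • L) = _
  rw [zero_smul, H0_zero]

/-- The family of spaces `H⁰(j L + E)`. -/
def twist (L E : C.Div) (j : ℕ) : Submodule ℂ C.F := C.H0 (j • L + E)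

instance (L E : C.Div) : (C.RL L).Stable (C.twist L E) :=
  ⟨fun {i j r x} hr hx => C.mul_mem_H0_of_eq (G := (i + j) • L + E) hr hx (by module)⟩

theorem mem_twist {L E G : C.Div} {j : ℕ} {x : C.F} (h : j • L + E = G) :
    x ∈ C.twist L E j ↔ x ∈ C.H0 G := by rw [← h]; rfl

variable {C} {L : C.Div}

/-- The sections of `O(E)` twisted by all powers of `L`, as a graded `R_L`-module. -/
def sections (L E : C.Div) : (C.RL L).SubQuot := SubQuot.of (C.twist L E) ⊥ fun _ => bot_le

/-- The quotient of `R_L` by the sections vanishing on a set of points. -/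
def restriction (L : C.Div) (T : Finset C.Point) : (C.RL L).SubQuot :=
  SubQuot.of (C.RL L).piece (cons ⊥ (C.twist L (L - C.divOfFinset T))) fun j => by
    cases j with
    | zero => exact bot_le
    | succ j =>
      refine C.H0_mono fun P => ?_
      classical
      rw [succ_nsmul]
      simp only [Finsupp.add_apply, Finsupp.sub_apply, divOfFinset_apply]
      split_ifs <;> omega

/-- The sections of the positive powers of `L` vanishing on `S`, modulo those vanishing on
`T`. -/
def vanishing (L : C.Div) {S T : Finset C.Point} (h : S ⊆ T) : (C.RL L).SubQuot :=
  SubQuot.of (C.twist L (L - C.divOfFinset S)) (C.twist L (L - C.divOfFinset T)) fun j =>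
    C.H0_mono fun P => by
      have := C.divOfFinset_mono h P
      simp only [Finsupp.add_apply, Finsupp.sub_apply]
      omega

theorem lin_restriction_of_vanishing {Pts T : Finset C.Point} {i : ℕ} (hT : T ⊆ Pts)
    (h1 : Mod.Lin i (restriction L Pts).toMod)
    (h2 : ∀ i', i = i' + 1 → Mod.Lin i' (vanishing L hT).toMod) :
    Mod.Lin i (restriction L T).toMod := by
  refine SubQuot.lin_of_quotient (vanishing L hT) (restriction L Pts) (restriction L T) 1 rfl
    (fun j => ?_) bot_le (fun j x hx => ?_) (fun j x hx => ?_) (fun j y hy => ⟨y, hy, ?_⟩) h1 h2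
  · cases j with
    | zero => exact bot_le
    | succ j => exact (vanishing L hT).le j
  · rw [one_mul]; exact hx
  · rw [one_mul]; rfl
  · rw [one_mul, sub_self]; exact zero_mem _

namespace PencilDecomposition

variable {Pts : Finset C.Point} {n : ℕ}

theorem lin_pencil (h : C.PencilDecomposition L Pts n) {i : ℕ}
    (hN : ∀ i', i = i' + 1 → Mod.Lin i' (sections L (C.divOfFinset Pts)).toMod) :
    Mod.Lin i (sections L (L - C.divOfFinset Pts)).toMod := by
  obtain ⟨s, hs, t, ht, hs0, ht0, hst⟩ := C.exists_pencil h.pencil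
  have hself := SubQuot.lin_self (C.connectedOne_RL L) i
  set D := C.divOfFinset Pts
  let sD : (C.RL L).SubQuot := SubQuot.of (C.RL L).piece (cons ⊥ (scale s (C.twist L D)))
    fun j => by
      cases j with
      | zero => exact bot_le
      | succ j =>
        rintro _ ⟨x, hx, rfl⟩
        exact C.mul_mem_H0_of_eq (G := (j + 1) • L) hs hx (by module)
  let sR : (C.RL L).SubQuot := SubQuot.of (scale s (C.RL L).piece) ⊥ fun _ => bot_le
  let qR : (C.RL L).SubQuot := SubQuot.of (C.twist L (L - D)) (scale s (C.RL L).piece)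
    fun j => by
      rintro _ ⟨x, hx, rfl⟩
      exact C.mul_mem_H0_of_eq (G := j • L + (L - D)) hs hx (add_comm _ _)
  have h1 : Mod.Lin i sD.toMod := by
    refine SubQuot.lin_of_quotient (sections L D) (SubQuot.self _) sD s rfl (fun _ => bot_le)
      bot_le (fun j x hx => ⟨x, hx, rfl⟩) (fun j x hx => ?_) ?_ hself hN
    · change s * x = 0 ↔ x = 0
      simp [hs0]
    · rintro j _ ⟨x, hx, rfl⟩
      exact ⟨x, hx, sub_self (s * x)⟩
  have h2 : Mod.Lin i qR.toMod := by
    refine SubQuot.lin_of_iso sD qR t (fun j x hx => C.mul_mem_H0_of_eq ht hx (add_comm _ _))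
      (fun j x hx => ⟨?_, ?_⟩) (fun j z hz => ?_) h1
    · rintro ⟨y, hy, hxy⟩
      obtain ⟨c, hc, hc', hc''⟩ := C.exists_mul_eq_of_pencil hs ht hs0 ht0 hst hy hx hxy
      cases j with
      | zero =>
        rw [zero_smul, zero_sub, C.H0_neg_eq_bot h.pencil.2.ge, Submodule.mem_bot] at hc
        rw [← hc'', hc, mul_zero]
        exact zero_mem _
      | succ j => exact ⟨c, (C.mem_twist (by module)).mpr hc, hc''⟩
    · intro hx
      cases j with
      | zero =>
        rw [(Submodule.mem_bot ℂ).mp hx, mul_zero]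
        exact zero_mem _
      | succ j =>
        obtain ⟨c, hc, rfl⟩ := hx
        exact ⟨t * c, C.mul_mem_H0_of_eq (G := (j + 1) • L) ht hc (by module), mul_left_comm s t c⟩
    · obtain ⟨x, hx, y, hy, rfl⟩ :=
        C.exists_add_mul_of_pencil hs ht hs0 ht0 hst (h.h0_pencil j) hz
      exact ⟨y, hy, x, hx, (add_sub_cancel_right _ _).symm⟩
  have h3 : Mod.Lin i sR.toMod := by
    refine SubQuot.lin_of_iso (SubQuot.self _) sR s (fun j x hx => ⟨x, hx, rfl⟩)
      (fun j x hx => ?_) ?_ hself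
    · change s * x = 0 ↔ x = 0
      simp [hs0]
    · rintro j _ ⟨x, hx, rfl⟩
      exact ⟨x, hx, sub_self (s * x)⟩
  exact SubQuot.lin_of_filtration sR (sections L (L - D)) qR rfl rfl rfl h3 h2

theorem lin_restriction_points (h : C.PencilDecomposition L Pts n) {i : ℕ}
    (hN : ∀ i', i = i' + 1 → Mod.Lin i' (sections L (C.divOfFinset Pts)).toMod) :
    Mod.Lin i (restriction L Pts).toMod := by
  refine SubQuot.lin_of_quotient (sections L (L - C.divOfFinset Pts)) (SubQuot.self _)
    (restriction L Pts) 1 rfl (fun _ => bot_le) bot_le (fun j x hx => ?_) (fun j x hx => ?_)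
    (fun j y hy => ⟨y, hy, ?_⟩) (SubQuot.lin_self (C.connectedOne_RL L) i) fun i' hi' => ?_
  · rw [one_mul]; exact hx
  · rw [one_mul]; rfl
  · rw [one_mul, sub_self]; exact zero_mem _
  · refine (h.lin_pencil fun i'' hi'' => ?_).of_succ (i := i')
    obtain rfl : i' = i'' := by omega
    exact hN i' hi'

end PencilDecomposition

theorem mem_restriction_Y {T : Finset C.Point} (hT : T.Nonempty) {j : ℕ} {x : C.F} :
    x ∈ (restriction L T).Y j ↔ x ∈ C.H0 (j • L - C.divOfFinset T) := by
  cases j with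
  | zero => rw [zero_smul, zero_sub, C.H0_neg_divOfFinset hT]; rfl
  | succ j => exact C.mem_twist (by module)

theorem lin_vanishing_trans {i : ℕ} {S T U : Finset C.Point} (hST : S ⊆ T) (hTU : T ⊆ U)
    (h : Mod.Lin i (vanishing L hST).toMod) (h' : Mod.Lin i (vanishing L hTU).toMod) :
    Mod.Lin i (vanishing L (hST.trans hTU)).toMod :=
  SubQuot.lin_of_filtration (vanishing L hTU) (vanishing L (hST.trans hTU)) (vanishing L hST)
    rfl rfl rfl h' h

namespace PencilDecomposition

variable {Pts : Finset C.Point} {n : ℕ}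

theorem h0_eq_add (h : C.PencilDecomposition L Pts n) {j : ℕ} {T : Finset C.Point} (hT : T ⊆ Pts)
    (hTn : T.card ≤ n + 1) :
    C.h0 ((j + 1) • L) = C.h0 ((j + 1) • L - C.divOfFinset T) + T.card := by
  cases j with
  | zero =>
    have h1 := h.h0_sub T hT hTn
    have h2 := h.h0_sub ∅ (Finset.empty_subset _) (by simp)
    rw [divOfFinset_empty, sub_zero, Finset.card_empty] at h2
    rw [zero_add, one_smul]
    omega
  | succ j => exact (h.h0_nsmul_sub j T hT).symm

theorem lin_vanishing_union [DecidableEq C.Point] (h : C.PencilDecomposition L Pts n) {i : ℕ}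
    {S T U : Finset C.Point} (hU : S ∪ T = U) (hSU : S ⊆ U)
    (hST : Disjoint S T) (hT : T.Nonempty) (hSP : S ⊆ Pts) (hTP : T ⊆ Pts)
    (hTn : T.card ≤ n + 1) {a : C.F} (ha : a ∈ C.H0 (L - C.divOfFinset S))
    (haT : ∀ P ∈ T, a ∉ C.H0 (L - C.divOfFinset S - C.pt P))
    (hdim : C.h0 (L - C.divOfFinset S) ≤ C.h0 (L - C.divOfFinset U) + 1)
    (hlin : Mod.Lin i (restriction L T).toMod) :
    Mod.Lin i (vanishing L hSU).toMod := by
  subst hU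
  have ha0 : a ≠ 0 := by
    obtain ⟨P, hP⟩ := hT
    exact (C.ord_eq_of_notMem ha (haT P hP)).1
  have hY : ∀ {j : ℕ} {x : C.F}, x ∈ (vanishing L hSU).Y j ↔
      x ∈ C.H0 (j • L + (L - C.divOfFinset S) - C.divOfFinset T) := fun {j x} =>
    C.mem_twist (by rw [divOfFinset_union C hST]; abel)
  refine SubQuot.lin_of_iso (restriction L T) _ a
    (fun j x hx => C.mul_mem_H0_of_eq ha hx (add_comm _ _)) (fun j x hx => ?_) (fun j y hy => ?_)
    hlin
  · rw [hY, mem_restriction_Y hT]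
    exact C.mul_mem_sub_divOfFinset_iff ha ha0 haT hx
  · have hj : C.h0 (j • L + (L - C.divOfFinset S)) + C.h0 (j • L - C.divOfFinset T) ≤
        C.h0 (j • L) + C.h0 (j • L + (L - C.divOfFinset S) - C.divOfFinset T) := by
      cases j with
      | zero =>
        have h0 : C.h0 (-C.divOfFinset T) = 0 := by
          rw [PreCurve.h0, C.H0_neg_divOfFinset hT, finrank_bot]
        rw [divOfFinset_union C hST, ← sub_sub] at hdim
        rw [zero_smul, zero_add, zero_sub, h0, C.h0_triv]
        omega
      | succ j =>
        have h1 := h.h0_eq_add (j := j) hTP hTn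
        have h2 := h.h0_nsmul_sub j S hSP
        have h3 := h.h0_nsmul_sub j (S ∪ T) (Finset.union_subset hSP hTP)
        rw [Finset.card_union_of_disjoint hST, divOfFinset_union C hST] at h3
        rw [show (j + 1) • L + (L - C.divOfFinset S) = (j + 2) • L - C.divOfFinset S by module,
          sub_sub]
        omega
    obtain ⟨x, hx, hxy⟩ := C.exists_sub_mul_mem ha ha0 haT hj hy
    exact ⟨x, hx, hY.mpr hxy⟩

theorem lin_vanishing (h : C.PencilDecomposition L Pts n) {i : ℕ}
    (hR : ∀ T ⊆ Pts, T.card ≤ n → Mod.Lin i (restriction L T).toMod) {S : Finset C.Point}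
    (hS : S ⊆ Pts) (hSn : S.card ≤ n) : Mod.Lin i (vanishing L hS).toMod := by
  classical
  have key : ∀ S ⊆ Pts, S.card ≤ n → ∀ P ∈ Pts \ S,
      C.h0 (L - C.divOfFinset S - C.pt P) + S.card = n + 2 ∧
        C.h0 (L - C.divOfFinset S) + S.card = n + 3 := by
    intro S hS hSn P hP
    rw [Finset.mem_sdiff] at hP
    have h1 := h.h0_sub (insert P S) (Finset.insert_subset hP.1 hS)
      (by rw [Finset.card_insert_of_notMem hP.2]; omega)
    rw [divOfFinset_insert C hP.2, ← sub_sub, Finset.card_insert_of_notMem hP.2] at h1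
    have h2 := h.h0_sub S hS (by omega)
    omega
  induction hm : n - S.card generalizing S with
  | zero =>
    have hS' : S.card = n := by omega
    have hne : (Pts \ S).Nonempty := by
      rw [← Finset.card_pos, Finset.card_sdiff_of_subset hS]
      have := h.lt_card
      omega
    have hle : C.H0 (L - C.divOfFinset Pts) ≤ C.H0 (L - C.divOfFinset S) :=
      C.H0_mono fun P => by
        have := C.divOfFinset_mono hS P
        simp only [Finsupp.sub_apply]
        omega
    obtain ⟨P, hP⟩ := hne
    obtain ⟨a, ha, ha'⟩ :
        ∃ a ∈ C.H0 (L - C.divOfFinset S), a ∉ C.H0 (L - C.divOfFinset Pts) := by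
      by_contra! hcon
      have h1 := Submodule.finrank_mono hcon
      have h2 := (key S hS hSn P hP).2
      have h3 := h.pencil.2
      simp only [PreCurve.h0] at h2 h3
      omega
    have haT : ∀ Q ∈ Pts \ S, a ∉ C.H0 (L - C.divOfFinset S - C.pt Q) := by
      intro Q hQ haQ
      have h1 : C.H0 (L - C.divOfFinset Pts) ≤ C.H0 (L - C.divOfFinset S - C.pt Q) :=
        C.H0_mono fun R => by
          rw [Finset.mem_sdiff] at hQ
          have := C.divOfFinset_mono (Finset.insert_subset hQ.1 hS) R
          rw [divOfFinset_insert C hQ.2] at this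
          simp only [Finsupp.sub_apply, Finsupp.add_apply] at *
          omega
      have h2 := Submodule.eq_of_le_of_finrank_le h1 (by
        have h2 := (key S hS hSn Q hQ).1
        have h3 := h.pencil.2
        simp only [PreCurve.h0] at h2 h3
        omega)
      exact ha' (h2 ▸ haQ)
    have hcard := Finset.card_sdiff_of_subset hS
    have hle := h.card_le
    exact h.lin_vanishing_union (Finset.union_sdiff_of_subset hS) hS Finset.disjoint_sdiff ⟨P, hP⟩
      hS Finset.sdiff_subset (by omega) ha haT
      (by have := (key S hS hSn P hP).2; rw [h.pencil.2]; omega)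
      (hR (Pts \ S) Finset.sdiff_subset (by omega))
  | succ m ih =>
    obtain ⟨P, hP⟩ : (Pts \ S).Nonempty := by
      rw [← Finset.card_pos, Finset.card_sdiff_of_subset hS]
      have := h.lt_card
      omega
    have hk := key S hS hSn P hP
    obtain ⟨a, ha, ha'⟩ :
        ∃ a ∈ C.H0 (L - C.divOfFinset S), a ∉ C.H0 (L - C.divOfFinset S - C.pt P) := by
      by_contra! hcon
      have h1 := Submodule.finrank_mono hcon
      simp only [PreCurve.h0] at hk
      omega
    have hP' := Finset.mem_sdiff.mp hP
    have hone := h.one_le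
    have hdisj : Disjoint S {P} := Finset.disjoint_singleton_right.mpr hP'.2
    have h1 := h.lin_vanishing_union (i := i) rfl Finset.subset_union_left hdisj
      (Finset.singleton_nonempty P) hS (Finset.singleton_subset_iff.mpr hP'.1) (by simp) ha
      (fun Q hQ => by rw [Finset.mem_singleton] at hQ; rwa [hQ])
      (by rw [divOfFinset_union C hdisj, divOfFinset_singleton, ← sub_sub]; omega)
      (hR {P} (Finset.singleton_subset_iff.mpr hP'.1) (by simpa using hone))
    have hcard := Finset.card_union_of_disjoint hdisj
    rw [Finset.card_singleton] at hcard
    have hSP := Finset.union_subset hS (Finset.singleton_subset_iff.mpr hP'.1)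
    have h2 := ih hSP (by omega) (by omega)
    exact lin_vanishing_trans Finset.subset_union_left hSP h1 h2

end PencilDecomposition

theorem stable_cons_twist {D : C.Div} {G : Submodule ℂ C.F} (hG : G ≤ C.H0 D) :
    (C.RL L).Stable (cons G (C.twist L (L + D))) :=
  Stable.cons (C.connectedOne_RL L) fun {i r x} hr hx =>
    C.mul_mem_H0_of_eq (G := i • L + (L + D)) hr (hG hx) (by module)

namespace PencilDecomposition

variable {Pts : Finset C.Point} {n : ℕ}

theorem lin_sections_of_span (h : C.PencilDecomposition L Pts n) {i : ℕ}
    (hPts : Mod.Lin i (restriction L Pts).toMod) {u : C.F} (hu : u ∈ C.H0 (C.divOfFinset Pts))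
    (huT : ∀ P ∈ Pts, u ∉ C.H0 (C.divOfFinset Pts - C.pt P))
    [(C.RL L).Stable (cons (Submodule.span ℂ {1, u}) (C.twist L (L + C.divOfFinset Pts)))] :
    Mod.Lin i (SubQuot.of (S := C.RL L)
      (cons (Submodule.span ℂ {1, u}) (C.twist L (L + C.divOfFinset Pts))) ⊥
      fun _ => bot_le).toMod := by
  classical
  have hne : Pts.Nonempty := Finset.card_pos.mp (h.lt_card.trans_le' (Nat.zero_le n))
  have hu0 : u ≠ 0 := by
    obtain ⟨P, hP⟩ := hne
    exact (C.ord_eq_of_notMem hu (huT P hP)).1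
  set D := C.divOfFinset Pts with hD
  set X := cons (Submodule.span ℂ {1, u}) (C.twist L (L + D))
  have hle : ∀ j, (C.RL L).piece j ≤ X j := fun j => by
    cases j with
    | zero =>
      rw [C.connectedOne_RL L]
      exact Submodule.span_mono (by simp)
    | succ j =>
      refine C.H0_mono fun P => ?_
      rw [succ_nsmul]
      simp only [hD, Finsupp.add_apply, divOfFinset_apply]
      split_ifs <;> omega
  let Q : (C.RL L).SubQuot := SubQuot.of X (C.RL L).piece hle
  have hQ : Mod.Lin i Q.toMod := by
    refine SubQuot.lin_of_iso (restriction L Pts) Q u (fun j x hx => ?_) (fun j x hx => ?_)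
      (fun j y hy => ?_) hPts
    · cases j with
      | zero =>
        rw [show x ∈ (restriction L Pts).X 0 ↔ x ∈ (C.RL L).piece 0 from Iff.rfl,
          C.connectedOne_RL L] at hx
        obtain ⟨c, rfl⟩ := Submodule.mem_span_singleton.mp hx
        rw [mul_smul_comm, mul_one]
        exact Submodule.smul_mem _ c (Submodule.subset_span (by simp))
      | succ j => exact C.mul_mem_H0_of_eq (G := j • L + (L + D)) hu hx (by module)
    · rw [mem_restriction_Y hne, ← C.mul_mem_sub_divOfFinset_iff hu hu0 huT hx, ← hD,
        add_sub_cancel_right]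
      rfl
    · cases j with
      | zero =>
        obtain ⟨c, z, hz, rfl⟩ := Submodule.mem_span_insert.mp
          (show y ∈ Submodule.span ℂ {1, u} from hy)
        obtain ⟨d, rfl⟩ := Submodule.mem_span_singleton.mp hz
        refine ⟨d • 1, Submodule.smul_mem _ d (C.RL L).one_mem, ?_⟩
        rw [mul_smul_comm, mul_one, add_sub_cancel_right]
        exact Submodule.smul_mem _ c (C.RL L).one_mem
      | succ j =>
        have hj := h.h0_divisor j
        obtain ⟨x, hx, hxy⟩ := C.exists_sub_mul_mem (G := (j + 1) • L) hu hu0 huT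
          (by rw [← hD, add_sub_cancel_right] at *; omega)
          ((C.mem_twist (by module)).mp (show y ∈ C.twist L (L + D) j from hy))
        rw [← hD, add_sub_cancel_right] at hxy
        exact ⟨x, hx, hxy⟩
  exact SubQuot.lin_of_filtration (SubQuot.self _) (SubQuot.of X ⊥ fun _ => bot_le) Q rfl rfl rfl
    (SubQuot.lin_self (C.connectedOne_RL L) i) hQ

end PencilDecomposition

theorem lin_cons_sup {D : C.Div} {i : ℕ} {G : Submodule ℂ C.F} {v : C.F}
    [(C.RL L).Stable (cons G (C.twist L (L + D)))]
    [(C.RL L).Stable (cons (G ⊔ Submodule.span ℂ {v}) (C.twist L (L + D)))]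
    (hv : v ∈ C.H0 D) (h₀ : Mod.Lin i (restriction L (∅ : Finset C.Point)).toMod)
    (h : Mod.Lin i (SubQuot.of (S := C.RL L) (cons G (C.twist L (L + D))) ⊥ fun _ => bot_le).toMod) :
    Mod.Lin i (SubQuot.of (S := C.RL L) (cons (G ⊔ Submodule.span ℂ {v}) (C.twist L (L + D))) ⊥
      fun _ => bot_le).toMod := by
  by_cases hvG : v ∈ G
  · have : G ⊔ Submodule.span ℂ {v} = G := by
      rw [sup_eq_left, Submodule.span_singleton_le_iff_mem]; exact hvG
    refine SubQuot.lin_of_iso _ _ 1 (fun j x hx => ?_) (fun j x _ => by rw [one_mul]; rfl)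
      (fun j y hy => ⟨y, ?_, by rw [one_mul, sub_self]; exact zero_mem _⟩) h
    · rw [one_mul]
      change x ∈ cons (G ⊔ Submodule.span ℂ {v}) _ j
      rw [this]; exact hx
    · change y ∈ cons (G ⊔ Submodule.span ℂ {v}) _ j at hy
      rw [this] at hy; exact hy
  let Q : (C.RL L).SubQuot := SubQuot.of (cons (G ⊔ Submodule.span ℂ {v}) (C.twist L (L + D)))
    (cons G (C.twist L (L + D))) fun j => by
      cases j with
      | zero => exact le_sup_left
      | succ j => exact le_rfl
  have hQ : Mod.Lin i Q.toMod := by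
    have hX : ∀ {j : ℕ} {x : C.F}, x ∈ C.H0 ((j + 1) • L) → v * x ∈ C.twist L (L + D) j :=
      fun {j x} hx => C.mul_mem_H0_of_eq (G := j • L + (L + D)) hv hx (by module)
    refine SubQuot.lin_of_iso (restriction L ∅) Q v (fun j x hx => ?_) (fun j x hx => ?_)
      (fun j y hy => ?_) h₀
    · cases j with
      | zero =>
        rw [show x ∈ (restriction L ∅).X 0 ↔ x ∈ (C.RL L).piece 0 from Iff.rfl,
          C.connectedOne_RL L] at hx
        obtain ⟨c, rfl⟩ := Submodule.mem_span_singleton.mp hx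
        rw [mul_smul_comm, mul_one]
        exact Submodule.mem_sup_right (Submodule.smul_mem _ c (Submodule.mem_span_singleton_self v))
      | succ j => exact hX hx
    · cases j with
      | zero =>
        rw [show x ∈ (restriction L ∅).X 0 ↔ x ∈ (C.RL L).piece 0 from Iff.rfl,
          C.connectedOne_RL L] at hx
        obtain ⟨c, rfl⟩ := Submodule.mem_span_singleton.mp hx
        rw [mul_smul_comm, mul_one]
        change c • v ∈ G ↔ c • (1 : C.F) = 0
        rcases eq_or_ne c 0 with rfl | hc
        · simp
        · simp [Submodule.smul_mem_iff _ hc, hvG, hc]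
      | succ j =>
        refine iff_of_true (hX hx) ((C.mem_twist (G := (j + 1) • L) ?_).mpr hx)
        rw [divOfFinset_empty]; module
    · cases j with
      | zero =>
        obtain ⟨g, hg, z, hz, rfl⟩ := Submodule.mem_sup.mp
          (show y ∈ G ⊔ Submodule.span ℂ {v} from hy)
        obtain ⟨c, rfl⟩ := Submodule.mem_span_singleton.mp hz
        refine ⟨c • 1, Submodule.smul_mem _ c (C.RL L).one_mem, ?_⟩
        rw [mul_smul_comm, mul_one, add_sub_cancel_right]
        exact hg
      | succ j => exact ⟨0, zero_mem _, by rw [mul_zero, sub_zero]; exact hy⟩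
  exact SubQuot.lin_of_filtration (SubQuot.of (cons G (C.twist L (L + D))) ⊥ fun _ => bot_le) _ Q
    rfl rfl rfl h hQ

namespace PencilDecomposition

variable {Pts : Finset C.Point} {n : ℕ}

theorem lin_sections (h : C.PencilDecomposition L Pts n) {i : ℕ}
    (hPts : Mod.Lin i (restriction L Pts).toMod)
    (h₀ : Mod.Lin i (restriction L (∅ : Finset C.Point)).toMod) :
    Mod.Lin i (sections L (C.divOfFinset Pts)).toMod := by
  classical
  obtain ⟨u, hu, huT⟩ := C.exists_notMem_of_basePointFree h.basePointFree Pts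
  set D := C.divOfFinset Pts with hD
  obtain ⟨F, hF⟩ := (Submodule.fg_iff_finiteDimensional (C.H0 D)).mpr inferInstance
  have hU : Submodule.span ℂ {1, u} ≤ C.H0 D := by
    rw [Submodule.span_le]
    rintro x (rfl | rfl)
    · exact C.one_mem_H0 fun P => by rw [hD, divOfFinset_apply]; split_ifs <;> norm_num
    · exact hu
  have key : ∀ F' : Finset C.F, F' ⊆ F → ∃ G : Submodule ℂ C.F, ↑F' ⊆ (G : Set C.F) ∧ G ≤ C.H0 D ∧
      ∃ _ : (C.RL L).Stable (cons G (C.twist L (L + D))),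
        Mod.Lin i (SubQuot.of (S := C.RL L) (cons G (C.twist L (L + D))) ⊥
          fun _ => bot_le).toMod := by
    intro F' hF'
    induction F' using Finset.induction_on with
    | empty =>
      have := stable_cons_twist (L := L) hU
      exact ⟨Submodule.span ℂ {1, u}, by simp, hU, this, h.lin_sections_of_span hPts hu huT⟩
    | insert v F' _ ih =>
      obtain ⟨G, hFG, hG, hs, hlin⟩ := ih ((Finset.subset_insert v F').trans hF')
      have hv : v ∈ C.H0 D := hF ▸ Submodule.subset_span (hF' (Finset.mem_insert_self v F'))
      have hG' : G ⊔ Submodule.span ℂ {v} ≤ C.H0 D :=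
        sup_le hG ((Submodule.span_singleton_le_iff_mem _ _).mpr hv)
      have := stable_cons_twist (L := L) hG'
      refine ⟨_, ?_, hG', this, lin_cons_sup hv h₀ hlin⟩
      rw [Finset.coe_insert, Set.insert_subset_iff]
      exact ⟨Submodule.mem_sup_right (Submodule.mem_span_singleton_self v),
        hFG.trans (SetLike.coe_subset_coe.mpr le_sup_left)⟩
  obtain ⟨G, hFG, hG, hs, hlin⟩ := key F subset_rfl
  obtain rfl : G = C.H0 D := le_antisymm hG (hF ▸ Submodule.span_le.mpr hFG)
  have hX : ∀ j, cons (C.H0 D) (C.twist L (L + D)) j = C.twist L D j := fun j => by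
    cases j with
    | zero => change C.H0 D = C.H0 (0 • L + D); rw [zero_smul, zero_add]
    | succ j =>
      change C.H0 (j • L + (L + D)) = C.H0 ((j + 1) • L + D)
      congr 1
      module
  refine SubQuot.lin_of_iso _ _ 1 (fun j x hx => ?_) (fun j x _ => by rw [one_mul]; rfl)
    (fun j y hy => ⟨y, ?_, by rw [one_mul, sub_self]; exact zero_mem _⟩) hlin
  · rw [one_mul]
    change x ∈ C.twist L D j
    rw [← hX]; exact hx
  · change y ∈ cons (C.H0 D) (C.twist L (L + D)) j
    rw [hX]; exact hy

theorem lin_restriction_and_sections (h : C.PencilDecomposition L Pts n) (i : ℕ) :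
    (∀ T ⊆ Pts, T.card ≤ n → Mod.Lin i (restriction L T).toMod) ∧
      Mod.Lin i (sections L (C.divOfFinset Pts)).toMod := by
  have step : ∀ i, (∀ i', i = i' + 1 → (∀ T ⊆ Pts, T.card ≤ n → Mod.Lin i' (restriction L T).toMod) ∧
      Mod.Lin i' (sections L (C.divOfFinset Pts)).toMod) →
      (∀ T ⊆ Pts, T.card ≤ n → Mod.Lin i (restriction L T).toMod) ∧
        Mod.Lin i (sections L (C.divOfFinset Pts)).toMod := by
    intro i ih
    have hPts := h.lin_restriction_points fun i' hi' => (ih i' hi').2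
    have hT : ∀ T ⊆ Pts, T.card ≤ n → Mod.Lin i (restriction L T).toMod := fun T hT hTn =>
      lin_restriction_of_vanishing hT hPts fun i' hi' => h.lin_vanishing (ih i' hi').1 hT hTn
    exact ⟨hT, h.lin_sections hPts (hT ∅ (Finset.empty_subset _) (Nat.zero_le n))⟩
  induction i with
  | zero => exact step 0 fun i' hi' => absurd hi' (Nat.succ_ne_zero i').symm
  | succ i ih =>
    refine step (i + 1) fun i' hi' => ?_
    obtain rfl : i = i' := by omega
    exact ih

theorem isKoszul (h : C.PencilDecomposition L Pts n) : (C.RL L).IsKoszul := by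
  have : FiniteDimensional ℂ ((C.RL L).piece 1) := C.finiteDim (1 • L)
  refine IsKoszul.of_lin (C.connectedOne_RL L) (restriction L ∅).toMod ?_ (fun j => ?_) fun i =>
    (h.lin_restriction_and_sections i).1 ∅ (Finset.empty_subset _) (Nat.zero_le n)
  · change Module.finrank ℂ (C.H0 (0 • L) ⧸ (⊥ : Submodule ℂ C.F).submoduleOf (C.H0 (0 • L))) = 1
    rw [(Submodule.quotEquivOfEqBot _ <| (Submodule.eq_bot_iff _).mpr fun x hx =>
      Subtype.ext hx).finrank_eq, zero_smul]
    exact C.h0_triv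
  · refine subsingleton_of_forall_eq 0 fun m => ?_
    obtain ⟨x, rfl⟩ := (restriction L ∅).cls_surjective (j + 1) m
    rw [SubQuot.cls_eq_zero]
    refine (C.mem_twist (G := (j + 1) • L) ?_).mpr x.2
    rw [divOfFinset_empty]; module

end PencilDecomposition

end Curve


/-!  ### STATEMENT 5

Let `C` be a smooth connected projective complex curve of genus `g` and `L` a very
ample line bundle on `C` with `deg L ≥ g+3` whose embedding is projectively normal.
Assume there is a divisor `D = P₁ + ⋯ + P_d` of `d` distinct points (given by the
finite set `Pts`), of degree `d = deg L − g − 1 + 2h¹(L)`, such that `|D|` and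
`|L(-D)|` are base-point free of (projective) dimensions `deg L − 2g + 4h¹(L) − 1`
and `1` respectively, that `h¹(L(D)) = h¹(L²(-D)) = 0`, and that any `h¹(L)` of the
points of `D` impose independent conditions on `K ⊗ L⁻¹(D)`.
Then the algebra `R_L = ⊕_{n≥0} H⁰(C, Lⁿ)` is Koszul. -/
theorem koszul_of_pencil_decomposition (C : Curve) (L : C.Div)
    (hVA : C.VeryAmple L) (hdegL : (C.genus : ℤ) + 3 ≤ C.deg L)
    (hPN : C.ProjectivelyNormal L)
    (Pts : Finset C.Point) (D : C.Div) (hD : D = C.divOfFinset Pts)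
    (hcard : (Pts.card : ℤ) = C.deg L - C.genus - 1 + 2 * C.h1 L)
    (hDbpf : C.BasePointFree D)
    (hDdim : (C.h0 D : ℤ) = C.deg L - 2 * C.genus + 4 * C.h1 L)
    (hLD : C.IsBPFPencil (L - D))
    (h1LD : C.h1 (L + D) = 0) (h1LLD : C.h1 (2 • L - D) = 0)
    (hind : ∀ s : Finset C.Point, s ⊆ Pts → s.card = C.h1 L →
      C.h0 (C.K - L + D - C.divOfFinset s) + C.h1 L = C.h0 (C.K - L + D)) :
    (C.RL L).IsKoszul := by
  subst hD
  exact (Curve.PencilDecomposition.of_curve hdegL hcard hDbpf hDdim hLD h1LD h1LLD hind).isKoszul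

end
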